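/- Let $F_1, F_2 : S^2 \to \mathbb{R}^3$ be smooth immersions inducing the same metric $\gamma$ and the same mean curvature $H$. Then their second fundamental forms are equal: $A_1 = A_2$. -/

import Mathlib

/-!
Statement 1: two smooth immersions of `S²` into `ℝ³` inducing the same metric and the same
mean curvature have equal second fundamental forms.
An immersion of `S²` is represented by a smooth map on a neighborhood of the standard unit
sphere in `ℝ³` (every smooth immersion of `S²` arises this way), restricted to the sphere.
-/

noncomputable section
open scoped RealInnerProductSpace

/-- Euclidean 3-space. -/
abbrev E3 := EuclideanSpace ℝ (Fin 3)

/-- The standard unit 2-sphere `S² ⊂ ℝ³`. -/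
def S2 : Set E3 := Metric.sphere (0 : E3) 1

/-- `v` is tangent to the standard sphere at `x ∈ S²`. -/
def Tang (x v : E3) : Prop := ⟪x, v⟫ = 0

/-- Differential of `F` at `x`. -/
def dF (F : E3 → E3) (x : E3) : E3 →L[ℝ] E3 := fderiv ℝ F x

/-- Metric on `S²` induced by `F` (pullback of the Euclidean metric): a smooth map on a
neighborhood of the sphere represents a map of `S²` by restriction. -/
def inducedMetric (F : E3 → E3) (x v w : E3) : ℝ := ⟪dF F x v, dF F x w⟫

/-- `F` restricts to a smooth immersion of the standard sphere `S²` into `ℝ³`. -/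
def IsImmersionOnSphere (F : E3 → E3) : Prop :=
  ContDiff ℝ (⊤ : ℕ∞) F ∧ ∀ x ∈ S2, ∀ v : E3, Tang x v → v ≠ 0 → dF F x v ≠ 0

/-- `ν` is a unit normal vector of the immersed surface `F(S²)` at `x ∈ S²`. -/
def IsUnitNormalAt (F : E3 → E3) (x ν : E3) : Prop :=
  ‖ν‖ = 1 ∧ ∀ v : E3, Tang x v → ⟪ν, dF F x v⟫ = 0

/-- Second fundamental form of the immersion `F|_{S²}` at `x ∈ S²` with respect to the unit
normal `ν`, evaluated on tangent vectors `v, w` of `S²` at `x`: the normal component of the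
intrinsic second derivative of `F` along the sphere (the term `⟪v,w⟫ • dF F x x` accounts for
the curvature of the parametrizing sphere). -/
def sff (F : E3 → E3) (x ν v w : E3) : ℝ :=
  ⟪ν, (fderiv ℝ (fun y => fderiv ℝ F y v) x) w - ⟪v, w⟫ • dF F x x⟫

/-- The trace of the bilinear form `A` with respect to the positive-definite bilinear form
`γ` on a 2-plane, computed in the basis `b₁, b₂`. -/
def traceFormula (γ A : E3 → E3 → ℝ) (b₁ b₂ : E3) : ℝ :=
  (γ b₁ b₁ * A b₂ b₂ + γ b₂ b₂ * A b₁ b₁ - 2 * γ b₁ b₂ * A b₁ b₂) /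
    (γ b₁ b₁ * γ b₂ b₂ - (γ b₁ b₂) ^ 2)

/-- `h` is the mean curvature at `x ∈ S²` of the immersion `F|_{S²}` with respect to the unit
normal `ν`: the trace of the second fundamental form with respect to the induced metric
(computed in any orthonormal tangent basis of the round sphere at `x`). -/
def IsMeanCurvAt (F : E3 → E3) (x ν : E3) (h : ℝ) : Prop :=
  IsUnitNormalAt F x ν ∧ ∀ b₁ b₂ : E3, Tang x b₁ → Tang x b₂ →
    ⟪b₁, b₂⟫ = 0 → ‖b₁‖ = 1 → ‖b₂‖ = 1 →
    h = traceFormula (inducedMetric F x) (sff F x ν) b₁ b₂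


/-! ### Directional derivatives on the plane -/

def pd {V : Type*} [NormedAddCommGroup V] [NormedSpace ℝ V] (X : ℂ) (f : ℂ → V) : ℂ → V :=
  fun z => fderiv ℝ f z X

def Sm {V : Type*} [NormedAddCommGroup V] [NormedSpace ℝ V] (f : ℂ → V) : Prop :=
  ContDiff ℝ (⊤ : ℕ∞) f

theorem Sm.pd {V : Type*} [NormedAddCommGroup V] [NormedSpace ℝ V] {f : ℂ → V} (hf : Sm f)
    (X : ℂ) : Sm (pd X f) := by
  unfold Sm _root_.pd at *
  exact (hf.fderiv_right (m := (⊤ : ℕ∞)) (by simp)).clm_apply contDiff_const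

theorem Sm.diff {V : Type*} [NormedAddCommGroup V] [NormedSpace ℝ V] {f : ℂ → V} (hf : Sm f) :
    Differentiable ℝ f := ContDiff.differentiable hf (by simp)

theorem Sm.cont {V : Type*} [NormedAddCommGroup V] [NormedSpace ℝ V] {f : ℂ → V} (hf : Sm f) :
    Continuous f := ContDiff.continuous hf

theorem pd_comm {V : Type*} [NormedAddCommGroup V] [NormedSpace ℝ V] {f : ℂ → V} (hf : Sm f)
    (X Y z : ℂ) : pd X (pd Y f) z = pd Y (pd X f) z := by
  have h : IsSymmSndFDerivAt ℝ f z :=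
    (ContDiff.contDiffAt hf).isSymmSndFDerivAt (by
      rw [minSmoothness_of_isRCLikeNormedField]; exact WithTop.coe_le_coe.2 le_top)
  have hd : DifferentiableAt ℝ (fderiv ℝ f) z :=
    ((ContDiff.fderiv_right (m := (⊤ : ℕ∞)) hf (by simp)).differentiable (by simp)) z
  have e : ∀ Y : ℂ, fderiv ℝ (fun y => fderiv ℝ f y Y) z =
      (fderiv ℝ (fderiv ℝ f) z).flip Y := by
    intro Y
    ext w
    rw [fderiv_clm_apply hd (by fun_prop)]
    simp
  unfold pd
  rw [e, e]
  exact h X Y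

theorem pd_mul {f g : ℂ → ℝ} {z : ℂ} (X : ℂ) (hf : DifferentiableAt ℝ f z)
    (hg : DifferentiableAt ℝ g z) :
    pd X (fun z => f z * g z) z = pd X f z * g z + f z * pd X g z := by
  unfold pd
  rw [fderiv_fun_mul hf hg]; simp; ring

theorem pd_add {f g : ℂ → ℝ} {z : ℂ} (X : ℂ) (hf : DifferentiableAt ℝ f z)
    (hg : DifferentiableAt ℝ g z) :
    pd X (fun z => f z + g z) z = pd X f z + pd X g z := by
  unfold pd
  rw [fderiv_fun_add hf hg]; simp

theorem pd_sub {f g : ℂ → ℝ} {z : ℂ} (X : ℂ) (hf : DifferentiableAt ℝ f z)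
    (hg : DifferentiableAt ℝ g z) :
    pd X (fun z => f z - g z) z = pd X f z - pd X g z := by
  unfold pd
  rw [fderiv_fun_sub hf hg]; simp

theorem pd_inner {f g : ℂ → E3} {z : ℂ} (X : ℂ) (hf : DifferentiableAt ℝ f z)
    (hg : DifferentiableAt ℝ g z) :
    pd X (fun z => ⟪f z, g z⟫) z = ⟪pd X f z, g z⟫ + ⟪f z, pd X g z⟫ := by
  unfold pd
  rw [fderiv_inner_apply ℝ hf hg]; ring

theorem pd_comp {f : ℂ → ℝ} {g : ℝ → ℝ} {z : ℂ} (X : ℂ) (hf : DifferentiableAt ℝ f z)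
    (hg : DifferentiableAt ℝ g (f z)) :
    pd X (fun z => g (f z)) z = deriv g (f z) * pd X f z := by
  unfold pd
  have := hg.hasDerivAt.comp_hasFDerivAt z hf.hasFDerivAt
  have h2 := this.fderiv
  rw [show (fun z => g (f z)) = g ∘ f from rfl, h2]; simp

/-! ### The analytic lemma -/

theorem bp_cutoff (δ t0 : ℝ) (hδ : 0 < δ) (ht0 : 0 < t0) : ∃ g : ℝ → ℝ,
    ContDiff ℝ 1 g ∧ (∀ t, t0 ≤ t → g t = t⁻¹) ∧
    g 0 = 0 ∧ ∀ t, 0 ≤ t → 0 ≤ t * (g t + t * deriv g t) ∧ t * (g t + t * deriv g t) ≤ δ := by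
  obtain ⟨M, hM⟩ : ∃ M, ∀ s, deriv Real.smoothTransition s ≤ M := by
    have hc : Continuous (deriv Real.smoothTransition) :=
      (Real.smoothTransition.contDiff (n := 1)).continuous_deriv (by simp)
    obtain ⟨M, hM⟩ := (isCompact_Icc (a := (-1:ℝ)) (b := 2)).exists_bound_of_continuousOn
      hc.continuousOn
    refine ⟨max M 0, fun s => ?_⟩
    by_cases h : s ∈ Set.Icc (-1:ℝ) 2
    · exact (le_trans (le_abs_self _) (hM s h)).trans (le_max_left _ _)
    · refine le_trans (le_of_eq ?_) (le_max_right _ _)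
      rw [Set.mem_Icc, not_and_or, not_le, not_le] at h
      rcases h with h | h
      · have : Real.smoothTransition =ᶠ[nhds s] fun _ => 0 := by
          filter_upwards [Iio_mem_nhds (show s < 0 by linarith)] with x hx
          exact Real.smoothTransition.zero_of_nonpos (le_of_lt hx)
        rw [this.deriv_eq]; simp
      · have : Real.smoothTransition =ᶠ[nhds s] fun _ => 1 := by
          filter_upwards [Ioi_mem_nhds (show 1 < s by linarith)] with x hx
          exact Real.smoothTransition.one_of_one_le (le_of_lt hx)
        rw [this.deriv_eq]; simp
  have hM0 : 0 ≤ M := le_trans (Real.smoothTransition.monotone.deriv_nonneg) (hM 0)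
  set c : ℝ := δ / (M + 1) with hc
  have hcpos : 0 < c := by positivity
  -- transition: h t = st (1 + c * (log t - log t0))
  set φ : ℝ → ℝ := fun t => 1 + c * (Real.log t - Real.log t0) with hφ
  set h : ℝ → ℝ := fun t => Real.smoothTransition (φ t) with hh
  have hφd : ∀ t, t ≠ 0 → HasDerivAt φ (c * t⁻¹) t := by
    intro t ht
    have := ((Real.hasDerivAt_log ht).sub_const (Real.log t0)).const_mul c |>.const_add 1
    simpa [hφ] using this
  have hzero : (fun t => h t * t⁻¹) =ᶠ[nhds 0] fun _ => 0 := by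
    have : Filter.Tendsto Real.log (nhdsWithin 0 {0}ᶜ) Filter.atBot := Real.tendsto_log_nhdsNE_zero
    have h2 := this.eventually (Filter.eventually_le_atBot (Real.log t0 - 1 / c))
    rw [eventually_nhdsWithin_iff] at h2
    filter_upwards [h2] with t ht
    by_cases h0 : t = 0
    · simp [h0]
    · have := ht h0
      have h3 : φ t ≤ 0 := by
        have : c * (Real.log t - Real.log t0) ≤ c * (- (1 / c)) := by
          apply mul_le_mul_of_nonneg_left _ hcpos.le; linarith
        have h4 : c * (-(1/c)) = -1 := by field_simp
        simp only [hφ]; linarith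
      simp [hh, Real.smoothTransition.zero_of_nonpos h3]
  refine ⟨fun t => h t * t⁻¹, ?_, ?_, by simp, ?_⟩
  · rw [contDiff_iff_contDiffAt]
    intro t
    by_cases ht : t = 0
    · subst ht
      exact contDiffAt_const.congr_of_eventuallyEq hzero
    · have h1 : ContDiffAt ℝ 1 φ t := by
        have := Real.contDiffAt_log (n := 1) |>.2 ht
        simp only [hφ]
        fun_prop
      have h2 : ContDiffAt ℝ 1 h t :=
        (Real.smoothTransition.contDiff (n := 1)).contDiffAt.comp t h1
      exact h2.mul (contDiffAt_inv ℝ ht)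
  · intro t ht
    have : 1 ≤ φ t := by
      have := Real.log_le_log ht0 ht
      simp only [hφ]
      have : 0 ≤ c * (Real.log t - Real.log t0) := mul_nonneg hcpos.le (by linarith)
      linarith
    simp [hh, Real.smoothTransition.one_of_one_le this]
  · intro t ht
    rcases ht.eq_or_lt with h0 | h0
    · subst h0; simp [hδ.le]
    · have hst : HasDerivAt Real.smoothTransition (deriv Real.smoothTransition (φ t)) (φ t) :=
        (((Real.smoothTransition.contDiff (n := 1)).differentiable (by simp)) _).hasDerivAt
      have h1 : HasDerivAt h (deriv Real.smoothTransition (φ t) * (c * t⁻¹)) t :=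
        hst.comp t (hφd t h0.ne')
      have h2 := (h1.mul (hasDerivAt_inv h0.ne'))
      have h3 : deriv (fun t => h t * t⁻¹) t = _ := h2.deriv
      have key : t * (h t * t⁻¹ + t * deriv (fun t => h t * t⁻¹) t) =
          c * deriv Real.smoothTransition (φ t) := by
        rw [h3]; field_simp; ring
      rw [key]
      have hd0 : 0 ≤ deriv Real.smoothTransition (φ t) := Real.smoothTransition.monotone.deriv_nonneg
      refine ⟨mul_nonneg hcpos.le hd0, ?_⟩
      calc c * deriv Real.smoothTransition (φ t) ≤ c * (M + 1) := by
            apply mul_le_mul_of_nonneg_left _ hcpos.le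
            linarith [hM (φ t)]
        _ = δ := by rw [hc]; field_simp

theorem bp_int_zero (P : ℂ → ℝ) (hP : ContDiff ℝ 1 P) (hs : HasCompactSupport P) (X : ℂ) :
    MeasureTheory.Integrable (pd X P) ∧ ∫ z, pd X P z = 0 := by
  have hc : Continuous (pd X P) := (hP.continuous_fderiv (by simp)).clm_apply continuous_const
  have hcs : HasCompactSupport (pd X P) := hs.fderiv_apply ℝ X
  have hi := hc.integrable_of_hasCompactSupport (μ := MeasureTheory.volume) hcs
  refine ⟨hi, ?_⟩
  have hP1 := hP.continuous.integrable_of_hasCompactSupport (μ := MeasureTheory.volume) hs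
  have := integral_mul_fderiv_eq_neg_fderiv_mul_of_integrable (μ := MeasureTheory.volume)
    (f := fun _ : ℂ => (1:ℝ)) (g := P) (v := X) (by simp)
    (by simp only [one_mul]; exact hi)
    (by simpa using hP1) (by simp) (fun x _ => hP.differentiable (by simp) x)
  simpa [pd] using this

theorem bp_div_identity (u v A : ℂ → ℝ) (hu : Sm u) (hv : Sm v) (z : ℂ)
    (hA : DifferentiableAt ℝ A z) (X Y : ℂ) :
    pd X (fun z => A z * (u z * pd Y v z - v z * pd Y u z)) z
      - pd Y (fun z => A z * (u z * pd X v z - v z * pd X u z)) z =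
    2 * A z * (pd X u z * pd Y v z - pd Y u z * pd X v z)
      + pd X A z * (u z * pd Y v z - v z * pd Y u z)
      - pd Y A z * (u z * pd X v z - v z * pd X u z) := by
  have du := hu.diff z
  have dv := hv.diff z
  have h1 := (hu.pd X).diff z
  have h2 := (hu.pd Y).diff z
  have h3 := (hv.pd X).diff z
  have h4 := (hv.pd Y).diff z
  rw [pd_mul X hA (by fun_prop), pd_mul Y hA (by fun_prop),
    pd_sub X (by fun_prop) (by fun_prop), pd_sub Y (by fun_prop) (by fun_prop),
    pd_mul X du h4, pd_mul X dv h2, pd_mul Y du h3, pd_mul Y dv h1,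
    pd_comm hu X Y, pd_comm hv X Y]
  ring

theorem bp_no_winding (u v : ℂ → ℝ) (hu : Sm u) (hv : Sm v)
    (hJ : ∀ R : ℝ, ∃ C : ℝ, ∀ z : ℂ, ‖z‖ ≤ R →
      -C * (u z ^ 2 + v z ^ 2) ≤
        pd 1 u z * pd Complex.I v z - pd Complex.I u z * pd 1 v z)
    (hB : ∃ R0 : ℝ, ∀ z : ℂ, R0 ≤ ‖z‖ →
      u z * fderiv ℝ v z (Complex.I * z) - v z * fderiv ℝ u z (Complex.I * z) < 0) : False := by
  obtain ⟨R0', hB'⟩ := hB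
  obtain ⟨R0, hR0, hB⟩ : ∃ R0 : ℝ, 0 ≤ R0 ∧ ∀ z : ℂ, R0 ≤ ‖z‖ →
      u z * fderiv ℝ v z (Complex.I * z) - v z * fderiv ℝ u z (Complex.I * z) < 0 :=
    ⟨max R0' 0, le_max_right _ _, fun z hz => hB' z ((le_max_left _ _).trans hz)⟩
  set K : ℂ → ℝ := fun z =>
    u z * fderiv ℝ v z (Complex.I * z) - v z * fderiv ℝ u z (Complex.I * z) with hK
  set t : ℂ → ℝ := fun z => u z ^ 2 + v z ^ 2 with ht
  have htS : Sm t := by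
    have hu' : ContDiff ℝ (⊤ : ℕ∞) u := hu
    have hv' : ContDiff ℝ (⊤ : ℕ∞) v := hv
    show ContDiff ℝ (⊤ : ℕ∞) (fun z => u z ^ 2 + v z ^ 2)
    fun_prop
  have htn : ∀ z, 0 ≤ t z := fun z => by simp only [ht]; positivity
  -- cutoff in space
  set χ : ℝ → ℝ := fun s => Real.smoothTransition (R0 ^ 2 + 1 - s) with hχ
  have hχS : ContDiff ℝ (⊤ : ℕ∞) χ := by
    apply (Real.smoothTransition.contDiff (n := ⊤)).comp
    fun_prop
  have hχa : Antitone χ := fun a b hab => Real.smoothTransition.monotone (by linarith)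
  set ns : ℂ → ℝ := fun z => z.re * z.re + z.im * z.im with hns
  have hnsn : ∀ z, ns z = ‖z‖ ^ 2 := fun z => by
    simp [hns, Complex.sq_norm, Complex.normSq_apply]
  have hreS : Sm (fun z : ℂ => z.re) := Complex.reCLM.contDiff
  have himS : Sm (fun z : ℂ => z.im) := Complex.imCLM.contDiff
  have hnsS : Sm ns := by
    have h1 : ContDiff ℝ (⊤ : ℕ∞) (fun z : ℂ => z.re) := hreS
    have h2 : ContDiff ℝ (⊤ : ℕ∞) (fun z : ℂ => z.im) := himS
    show ContDiff ℝ (⊤ : ℕ∞) (fun z : ℂ => z.re * z.re + z.im * z.im)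
    fun_prop
  have hpre : ∀ X z, pd X (fun z : ℂ => z.re) z = X.re := fun X z => by
    have : fderiv ℝ (fun z : ℂ => z.re) z = Complex.reCLM := Complex.reCLM.fderiv
    simp [pd, this]
  have hpim : ∀ X z, pd X (fun z : ℂ => z.im) z = X.im := fun X z => by
    have : fderiv ℝ (fun z : ℂ => z.im) z = Complex.imCLM := Complex.imCLM.fderiv
    simp [pd, this]
  have hpns : ∀ X z, pd X ns z = 2 * (X.re * z.re + X.im * z.im) := fun X z => by
    have d1 := hreS.diff z
    have d2 := himS.diff z
    simp only [hns]
    rw [pd_add X (d1.fun_mul d1) (d2.fun_mul d2), pd_mul X d1 d1, pd_mul X d2 d2, hpre, hpim]; ring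
  set η : ℂ → ℝ := fun z => χ (ns z) with hη
  have hηS : Sm η := hχS.comp hnsS
  have hη0 : ∀ z, 0 ≤ η z := fun z => Real.smoothTransition.nonneg _
  have hη1 : ∀ z, η z ≤ 1 := fun z => Real.smoothTransition.le_one _
  have hpη : ∀ X z, pd X η z = deriv χ (ns z) * pd X ns z := fun X z =>
    pd_comp X (hnsS.diff z) (hχS.differentiable (by simp) _)
  have hηsupp : ∀ z, z ∉ Metric.closedBall (0:ℂ) (R0 + 1) → η z = 0 := by
    intro z hz
    apply Real.smoothTransition.zero_of_nonpos
    rw [hnsn]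
    simp only [Metric.mem_closedBall, dist_zero_right, not_le] at hz
    nlinarith
  have hηcs : HasCompactSupport η :=
    HasCompactSupport.intro (isCompact_closedBall (0:ℂ) (R0 + 1)) (fun z hz => hηsupp z hz)
  -- the derivative of χ vanishes away from the annulus
  have hχd1 : ∀ s, s < R0 ^ 2 → deriv χ s = 0 := by
    intro s hs
    have : χ =ᶠ[nhds s] fun _ => 1 := by
      filter_upwards [Iio_mem_nhds hs] with x hx
      have hx' : x < R0 ^ 2 := hx
      exact Real.smoothTransition.one_of_one_le (by linarith)
    rw [this.deriv_eq]; simp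
  have hχd2 : ∀ s, R0 ^ 2 + 1 < s → deriv χ s = 0 := by
    intro s hs
    have : χ =ᶠ[nhds s] fun _ => 0 := by
      filter_upwards [Ioi_mem_nhds hs] with x hx
      have hx' : R0 ^ 2 + 1 < x := hx
      exact Real.smoothTransition.zero_of_nonpos (by linarith)
    rw [this.deriv_eq]; simp
  -- t is bounded below on the annulus
  have htpos : ∀ z, R0 ≤ ‖z‖ → 0 < t z := by
    intro z hz
    rcases (htn z).eq_or_lt with h | h
    · exfalso
      have h1 : u z = 0 := by
        have : u z ^ 2 + v z ^ 2 = 0 := h.symm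
        nlinarith [sq_nonneg (u z), sq_nonneg (v z)]
      have h2 : v z = 0 := by
        have : u z ^ 2 + v z ^ 2 = 0 := h.symm
        nlinarith [sq_nonneg (u z), sq_nonneg (v z)]
      have := hB z hz
      simp [h1, h2] at this
    · exact h
  obtain ⟨t0, ht0, htann⟩ : ∃ t0 : ℝ, 0 < t0 ∧ ∀ z, R0 ≤ ‖z‖ → ‖z‖ ≤ R0 + 1 → t0 ≤ t z := by
    have hcomp : IsCompact (Metric.closedBall (0:ℂ) (R0 + 1) ∩ {z | R0 ≤ ‖z‖}) :=
      (isCompact_closedBall _ _).inter_right (isClosed_le continuous_const continuous_norm)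
    have hne : (Metric.closedBall (0:ℂ) (R0 + 1) ∩ {z | R0 ≤ ‖z‖}).Nonempty := by
      refine ⟨(R0 : ℂ), ?_, ?_⟩ <;> simp [abs_of_nonneg hR0]
    obtain ⟨z1, hz1, hmin⟩ := hcomp.exists_isMinOn hne htS.cont.continuousOn
    refine ⟨t z1, htpos z1 hz1.2, fun z h1 h2 => hmin ⟨by simpa using h2, h1⟩⟩
  have hann : ∀ z, deriv χ (ns z) ≠ 0 → R0 ≤ ‖z‖ ∧ ‖z‖ ≤ R0 + 1 := by
    intro z hz
    constructor
    · by_contra h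
      push Not at h
      exact hz (hχd1 _ (by rw [hnsn]; nlinarith [norm_nonneg z]))
    · by_contra h
      push Not at h
      exact hz (hχd2 _ (by rw [hnsn]; nlinarith [norm_nonneg z]))
  -- the flux
  have hKeq : ∀ z, K z = z.re * (u z * pd Complex.I v z - v z * pd Complex.I u z)
      - z.im * (u z * pd 1 v z - v z * pd 1 u z) := by
    intro z
    have e : Complex.I * z = (-z.im) • (1:ℂ) + z.re • Complex.I := by
      apply Complex.ext <;> simp
    simp only [hK, pd]
    rw [e, map_add, map_add, map_smul, map_smul, map_smul, map_smul]
    simp only [smul_eq_mul]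
    ring
  -- identity for every g
  have main : ∀ g : ℝ → ℝ, ContDiff ℝ 1 g →
      MeasureTheory.Integrable (fun z => η z * (2 * (g (t z) + t z * deriv g (t z)) *
        (pd 1 u z * pd Complex.I v z - pd Complex.I u z * pd 1 v z))) ∧
      Continuous (fun z => 2 * deriv χ (ns z) * g (t z) * K z) ∧
      HasCompactSupport (fun z => 2 * deriv χ (ns z) * g (t z) * K z) ∧
      (∫ z, η z * (2 * (g (t z) + t z * deriv g (t z)) *
        (pd 1 u z * pd Complex.I v z - pd Complex.I u z * pd 1 v z))) +
        ∫ z, 2 * deriv χ (ns z) * g (t z) * K z = 0 := by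
    intro g hg
    set A : ℂ → ℝ := fun z => η z * g (t z) with hA
    have hgt : ContDiff ℝ 1 (fun z => g (t z)) :=
      hg.comp (ContDiff.of_le htS (by exact_mod_cast le_top))
    have hA1 : ContDiff ℝ 1 A := (ContDiff.of_le hηS (by exact_mod_cast le_top)).mul hgt
    have hAcs : HasCompactSupport A := hηcs.mul_right
    have hcd : ∀ X, ContDiff ℝ 1 (fun z => u z * pd X v z - v z * pd X u z) := by
      intro X
      have a1 : ContDiff ℝ 1 u := ContDiff.of_le hu (by exact_mod_cast le_top)
      have a2 : ContDiff ℝ 1 v := ContDiff.of_le hv (by exact_mod_cast le_top)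
      have a3 : ContDiff ℝ 1 (pd X u) := ContDiff.of_le (hu.pd X) (by exact_mod_cast le_top)
      have a4 : ContDiff ℝ 1 (pd X v) := ContDiff.of_le (hv.pd X) (by exact_mod_cast le_top)
      fun_prop
    obtain ⟨i1, e1⟩ := bp_int_zero _ (hA1.mul (hcd Complex.I)) hAcs.mul_right 1
    obtain ⟨i2, e2⟩ := bp_int_zero _ (hA1.mul (hcd 1)) hAcs.mul_right Complex.I
    have hpt : ∀ X z, pd X t z = 2 * (u z * pd X u z + v z * pd X v z) := by
      intro X z
      have d1 := hu.diff z
      have d2 := hv.diff z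
      have : t = fun z => u z * u z + v z * v z := by funext z; simp only [ht]; ring
      rw [this, pd_add X (d1.fun_mul d1) (d2.fun_mul d2), pd_mul X d1 d1, pd_mul X d2 d2]; ring
    have hpA : ∀ X z, pd X A z = deriv χ (ns z) * pd X ns z * g (t z)
        + η z * (deriv g (t z) * pd X t z) := by
      intro X z
      simp only [hA]
      rw [pd_mul X (hηS.diff z) (hgt.differentiable (by simp) z), hpη,
        pd_comp X (htS.diff z) (hg.differentiable (by simp) _)]
    have hid : ∀ z, pd 1 (fun z => A z * (u z * pd Complex.I v z - v z * pd Complex.I u z)) z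
      - pd Complex.I (fun z => A z * (u z * pd 1 v z - v z * pd 1 u z)) z =
      η z * (2 * (g (t z) + t z * deriv g (t z)) *
        (pd 1 u z * pd Complex.I v z - pd Complex.I u z * pd 1 v z)) +
        2 * deriv χ (ns z) * g (t z) * K z := by
      intro z
      rw [bp_div_identity u v A hu hv z (hA1.differentiable (by simp) z), hpA, hpA, hpt, hpt,
        hKeq, hpns, hpns]
      simp only [hA, ht, Complex.one_re, Complex.one_im, Complex.I_re, Complex.I_im]
      ring
    have c1 : Continuous (deriv χ) := hχS.continuous_deriv (by simp)
    have c2 : Continuous (deriv g) := hg.continuous_deriv (by simp)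
    have c3 := hg.continuous
    have c4 := htS.cont
    have c5 := hnsS.cont
    have c6 := hηS.cont
    have c7 := (hu.pd 1).cont
    have c8 := (hu.pd Complex.I).cont
    have c9 := (hv.pd 1).cont
    have c10 := (hv.pd Complex.I).cont
    have c11 := hu.cont
    have c12 := hv.cont
    have cK : Continuous K := by
      rw [show K = _ from funext hKeq]
      have := hreS.cont
      have := himS.cont
      fun_prop
    have I1 : MeasureTheory.Integrable (fun z => η z * (2 * (g (t z) + t z * deriv g (t z)) *
        (pd 1 u z * pd Complex.I v z - pd Complex.I u z * pd 1 v z))) := by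
      apply Continuous.integrable_of_hasCompactSupport
      · fun_prop
      · exact hηcs.mul_right
    have C2 : Continuous (fun z => 2 * deriv χ (ns z) * g (t z) * K z) := by fun_prop
    have S2 : HasCompactSupport (fun z => 2 * deriv χ (ns z) * g (t z) * K z) := by
      apply HasCompactSupport.intro (isCompact_closedBall (0:ℂ) (R0 + 1))
      intro z hz
      have : deriv χ (ns z) = 0 := by
        by_contra h
        exact hz (by simpa using (hann z h).2)
      simp [this]
    refine ⟨I1, C2, S2, ?_⟩
    rw [← MeasureTheory.integral_add I1 (C2.integrable_of_hasCompactSupport S2)]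
    rw [← MeasureTheory.integral_congr_ae (Filter.Eventually.of_forall hid)]
    rw [MeasureTheory.integral_sub i1 i2, e1, e2, sub_zero]
  obtain ⟨g0, hg0, hg0i, -⟩ := bp_cutoff 1 t0 one_pos ht0
  obtain ⟨-, C0, S0, -⟩ := main g0 hg0
  have hKneg : ∀ z, R0 ≤ ‖z‖ → K z < 0 := hB
  have hSpos : 0 < ∫ z, 2 * deriv χ (ns z) * g0 (t z) * K z := by
    obtain ⟨s, hs, hds⟩ : ∃ s ∈ Set.Ioo (R0 ^ 2) (R0 ^ 2 + 1), deriv χ s = -1 := by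
      obtain ⟨s, hs, h⟩ := exists_deriv_eq_slope χ (show R0 ^ 2 < R0 ^ 2 + 1 by linarith)
        hχS.continuous.continuousOn (hχS.differentiable (by simp)).differentiableOn
      refine ⟨s, hs, ?_⟩
      rw [h]; simp [hχ]
    have hs0 : 0 ≤ s := le_trans (sq_nonneg R0) hs.1.le
    have hnsz : ns (Real.sqrt s : ℂ) = s := by
      simp [hns, Real.mul_self_sqrt hs0]
    apply C0.integral_pos_of_hasCompactSupport_nonneg_nonzero S0 (x := (Real.sqrt s : ℂ))
    · intro z
      show 0 ≤ 2 * deriv χ (ns z) * g0 (t z) * K z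
      by_cases h : deriv χ (ns z) = 0
      · simp [h]
      · obtain ⟨h1, h2⟩ := hann z h
        have a1 : deriv χ (ns z) ≤ 0 := hχa.deriv_nonpos
        rw [hg0i _ (htann z h1 h2)]
        have a2 : 0 ≤ (t z)⁻¹ := inv_nonneg.2 (htn z)
        have a3 := (hKneg z h1).le
        have : 0 ≤ (deriv χ (ns z) * K z) * (t z)⁻¹ :=
          mul_nonneg (mul_nonneg_of_nonpos_of_nonpos a1 a3) a2
        nlinarith
    · have hd : deriv χ (ns (Real.sqrt s : ℂ)) ≠ 0 := by rw [hnsz, hds]; norm_num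
      obtain ⟨h1, h2⟩ := hann _ hd
      rw [hg0i _ (htann _ h1 h2)]
      have := (hKneg _ h1).ne
      have := (htpos _ h1).ne'
      positivity
  obtain ⟨C', hC'⟩ := hJ (R0 + 1)
  obtain ⟨C, hC0, hC⟩ : ∃ C : ℝ, 0 ≤ C ∧ ∀ z : ℂ, ‖z‖ ≤ R0 + 1 → -C * t z ≤
        pd 1 u z * pd Complex.I v z - pd Complex.I u z * pd 1 v z :=
    ⟨max C' 0, le_max_right _ _, fun z hz => le_trans
      (mul_le_mul_of_nonneg_right (neg_le_neg (le_max_left _ _)) (htn z)) (hC' z hz)⟩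
  set σ := ∫ z, 2 * deriv χ (ns z) * g0 (t z) * K z with hσ
  have hIη : MeasureTheory.Integrable η :=
    hηS.cont.integrable_of_hasCompactSupport hηcs
  set V := ∫ z, η z with hV
  have hV0 : 0 ≤ V := MeasureTheory.integral_nonneg hη0
  set δ := σ / (2 * (2 * C * V + 1)) with hδ
  have hδp : 0 < δ := by positivity
  obtain ⟨g, hg, hgi, hgz, hgb⟩ := bp_cutoff δ t0 hδp ht0
  obtain ⟨I1, -, -, hsum⟩ := main g hg
  have hsame : (∫ z, 2 * deriv χ (ns z) * g (t z) * K z) = σ := by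
    apply MeasureTheory.integral_congr_ae
    refine Filter.Eventually.of_forall (fun z => ?_)
    by_cases h : deriv χ (ns z) = 0
    · simp [h]
    · obtain ⟨h1, h2⟩ := hann z h
      simp only
      rw [hg0i _ (htann z h1 h2), hgi _ (htann z h1 h2)]
  have hlow : -(2 * C * δ) * V ≤ ∫ z, η z * (2 * (g (t z) + t z * deriv g (t z)) *
        (pd 1 u z * pd Complex.I v z - pd Complex.I u z * pd 1 v z)) := by
    rw [hV, ← MeasureTheory.integral_const_mul]
    apply MeasureTheory.integral_mono (hIη.const_mul _) I1
    intro z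
    simp only
    by_cases hz : z ∈ Metric.closedBall (0:ℂ) (R0 + 1)
    · have hz' : ‖z‖ ≤ R0 + 1 := by simpa using hz
      obtain ⟨b1, b2⟩ := hgb (t z) (htn z)
      set G := g (t z) + t z * deriv g (t z)
      set J := pd 1 u z * pd Complex.I v z - pd Complex.I u z * pd 1 v z
      have hJz : -C * t z ≤ J := hC z hz'
      have : -(2 * C * δ) ≤ 2 * G * J := by
        rcases (htn z).eq_or_lt with h | h
        · rw [← h] at hJz
          have hG : G = 0 := by simp [G, ← h, hgz]
          rw [hG]
          nlinarith [mul_nonneg hC0 hδp.le]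
        · have hG : 0 ≤ G := by
            by_contra hneg
            push Not at hneg
            nlinarith
          have : G * (-C * t z) ≤ G * J := mul_le_mul_of_nonneg_left hJz hG
          nlinarith
      calc -(2 * C * δ) * η z = η z * -(2 * C * δ) := by ring
        _ ≤ η z * (2 * G * J) := mul_le_mul_of_nonneg_left this (hη0 z)
    · rw [hηsupp z hz]; simp
  rw [hsame] at hsum
  have : 2 * C * δ * V ≤ σ / 2 := by
    rw [hδ]
    have hp : 0 < 2 * C * V + 1 := by positivity
    rw [show 2 * C * (σ / (2 * (2 * C * V + 1))) * V = σ / 2 * ((2 * C * V) / (2 * C * V + 1)) by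
      field_simp]
    have h2 : (2 * C * V) / (2 * C * V + 1) ≤ 1 := by
      rw [div_le_one hp]; linarith
    nlinarith
  linarith

theorem bp_elliptic_alg (κ1 κ2 rx ry mx my e1 e2 k : ℝ) (hk0 : 0 ≤ k) (hk1 : k < 1)
    (hk : κ1 ^ 2 + κ2 ^ 2 ≤ k ^ 2)
    (h1 : (κ1 * ry + κ2 * my) + ry - mx = e1) (h2 : my - (κ1 * rx + κ2 * mx) + rx = e2) :
    -(4 / (1 - k)) * (e1 ^ 2 + e2 ^ 2) ≤ rx * (-my) - ry * (-mx) := by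
  set bz : ℂ := ⟨(rx - my) / 2, (-mx - ry) / 2⟩ with hbz
  set bw : ℂ := ⟨(rx + my) / 2, (ry - mx) / 2⟩ with hbw
  set κ : ℂ := ⟨κ1, κ2⟩ with hκ
  set e : ℂ := ⟨e2, e1⟩ with he
  have heq : (2:ℂ) * bw = κ * bz + (starRingEnd ℂ) κ * (starRingEnd ℂ) bw + e := by
    apply Complex.ext
    · simp [hbz, hbw, hκ, he, ← h1, ← h2]; ring
    · simp [hbz, hbw, hκ, he, ← h1, ← h2]; ring
  have hκn : ‖κ‖ ≤ k := by
    apply abs_le_of_sq_le_sq' _ hk0 |>.2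
    rw [Complex.sq_norm, Complex.normSq_apply]; simp [hκ]; nlinarith
  have hn : 2 * ‖bw‖ ≤ k * ‖bz‖ + k * ‖bw‖ + ‖e‖ := by
    calc 2 * ‖bw‖ = ‖(2:ℂ) * bw‖ := by simp
      _ = ‖κ * bz + (starRingEnd ℂ) κ * (starRingEnd ℂ) bw + e‖ := by rw [heq]
      _ ≤ ‖κ * bz‖ + ‖(starRingEnd ℂ) κ * (starRingEnd ℂ) bw‖ + ‖e‖ := norm_add₃_le
      _ = ‖κ‖ * ‖bz‖ + ‖κ‖ * ‖bw‖ + ‖e‖ := by simp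
      _ ≤ _ := by gcongr
  have hJ : rx * (-my) - ry * (-mx) = ‖bz‖ ^ 2 - ‖bw‖ ^ 2 := by
    rw [Complex.sq_norm, Complex.normSq_apply, Complex.sq_norm, Complex.normSq_apply]
    simp [hbz, hbw]; ring
  have hee : e1 ^ 2 + e2 ^ 2 = ‖e‖ ^ 2 := by
    rw [Complex.sq_norm, Complex.normSq_apply]; simp [he]; ring
  rw [hJ, hee]
  have hp := norm_nonneg bz
  have hs := norm_nonneg bw
  have hE := norm_nonneg e
  set p := ‖bz‖
  set s := ‖bw‖
  set E := ‖e‖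
  have hd : 0 < 1 - k := by linarith
  rw [neg_mul, div_mul_eq_mul_div, neg_le, neg_sub, le_div_iff₀ hd]
  -- s ≤ k p + E
  have hs1 : s ≤ k * p + E := by nlinarith
  have : s ^ 2 ≤ (k * p + E) ^ 2 := by gcongr
  by_cases hcase : s ≤ p
  · nlinarith [sq_nonneg E, mul_nonneg (sub_nonneg.2 hcase) (add_nonneg hp hs)]
  · push Not at hcase
    -- p < s, so (1-k) s ≤ E
    have a1 : (1 - k) * s ≤ E := by nlinarith
    have a2 : (2 - k) * (s - p) ≤ E := by nlinarith
    have a3 : s - p ≤ E := by nlinarith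
    calc (s ^ 2 - p ^ 2) * (1 - k) = (s - p) * ((1 - k) * (s + p)) := by ring
      _ ≤ E * (2 * E) := by
        apply mul_le_mul a3 _ (by positivity) hE
        nlinarith
      _ ≤ 4 * E ^ 2 := by nlinarith [sq_nonneg E]

theorem bp_elliptic (r m κ1 κ2 a b c d : ℂ → ℝ) (hr : Sm r) (hm : Sm m)
    (h1 : Sm κ1) (h2 : Sm κ2) (ha : Continuous a) (hb : Continuous b) (hc : Continuous c)
    (hd : Continuous d) (hκ : ∀ z, κ1 z ^ 2 + κ2 z ^ 2 < 1)
    (hA : ∀ z, pd Complex.I (fun z => κ1 z * r z + κ2 z * m z) z + pd Complex.I r z - pd 1 m z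
      = a z * r z + b z * m z)
    (hB : ∀ z, pd Complex.I m z - pd 1 (fun z => κ1 z * r z + κ2 z * m z) z + pd 1 r z
      = c z * r z + d z * m z) (R : ℝ) : ∃ C : ℝ, ∀ z : ℂ, ‖z‖ ≤ R →
      -C * (r z ^ 2 + (-m z) ^ 2) ≤
        pd 1 r z * pd Complex.I (fun z => -m z) z - pd Complex.I r z * pd 1 (fun z => -m z) z := by
  have hpd : ∀ X z, pd X (fun z => κ1 z * r z + κ2 z * m z) z =
      (κ1 z * pd X r z + κ2 z * pd X m z) + (pd X κ1 z * r z + pd X κ2 z * m z) := by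
    intro X z
    rw [pd_add X ((h1.diff z).fun_mul (hr.diff z)) ((h2.diff z).fun_mul (hm.diff z)),
      pd_mul X (h1.diff z) (hr.diff z), pd_mul X (h2.diff z) (hm.diff z)]
    ring
  have hneg : ∀ X z, pd X (fun z => -m z) z = - pd X m z := by
    intro X z; simp [pd, fderiv_fun_neg]
  have hcomp := isCompact_closedBall (0:ℂ) R
  -- uniform bound on κ
  obtain ⟨k, hk0, hk1, hk⟩ : ∃ k : ℝ, 0 ≤ k ∧ k < 1 ∧ ∀ z : ℂ, ‖z‖ ≤ R →
      κ1 z ^ 2 + κ2 z ^ 2 ≤ k ^ 2 := by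
    by_cases hne : (Metric.closedBall (0:ℂ) R).Nonempty
    · have hcont : Continuous (fun z => κ1 z ^ 2 + κ2 z ^ 2) :=
        (h1.cont.pow 2).add (h2.cont.pow 2)
      obtain ⟨z1, -, hmax⟩ := hcomp.exists_isMaxOn hne hcont.continuousOn
      refine ⟨Real.sqrt (κ1 z1 ^ 2 + κ2 z1 ^ 2), Real.sqrt_nonneg _, ?_, ?_⟩
      · rw [Real.sqrt_lt' one_pos]; simpa using hκ z1
      · intro z hz
        rw [Real.sq_sqrt (by positivity)]
        exact hmax (by simpa using hz)
    · refine ⟨0, le_rfl, one_pos, fun z hz => ?_⟩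
      exact absurd ⟨z, by simpa using hz⟩ hne
  obtain ⟨D, hD⟩ := hcomp.exists_bound_of_continuousOn
    (f := fun z => (a z - pd Complex.I κ1 z) ^ 2 + (b z - pd Complex.I κ2 z) ^ 2 +
      (c z + pd 1 κ1 z) ^ 2 + (d z + pd 1 κ2 z) ^ 2) (by
        have q1 := (h1.pd Complex.I).cont
        have q2 := (h2.pd Complex.I).cont
        have q3 := (h1.pd 1).cont
        have q4 := (h2.pd 1).cont
        apply Continuous.continuousOn
        fun_prop)
  refine ⟨4 / (1 - k) * D, fun z hz => ?_⟩
  have hDz := (le_abs_self _).trans (hD z (by simpa using hz))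
  have hAz := hA z
  have hBz := hB z
  rw [hpd] at hAz hBz
  rw [hneg, hneg]
  refine le_trans ?_ (bp_elliptic_alg (κ1 z) (κ2 z) (pd 1 r z) (pd Complex.I r z) (pd 1 m z)
    (pd Complex.I m z)
    ((a z - pd Complex.I κ1 z) * r z + (b z - pd Complex.I κ2 z) * m z)
    ((c z + pd 1 κ1 z) * r z + (d z + pd 1 κ2 z) * m z) k hk0 hk1 (hk z hz)
    (by linarith) (by linarith))
  generalize a z - pd Complex.I κ1 z = A at *
  generalize b z - pd Complex.I κ2 z = B at *
  generalize c z + pd 1 κ1 z = C at *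
  generalize d z + pd 1 κ2 z = E at *
  have hq : 0 ≤ 4 / (1 - k) := div_nonneg (by norm_num) (by linarith)
  have hcs : (A * r z + B * m z) ^ 2 + (C * r z + E * m z) ^ 2 ≤ D * (r z ^ 2 + (-m z) ^ 2) := by
    have s1 : 0 ≤ r z ^ 2 + m z ^ 2 := by positivity
    have := mul_le_mul_of_nonneg_right hDz s1
    nlinarith [sq_nonneg (A * m z - B * r z), sq_nonneg (C * m z - E * r z)]
  have := mul_le_mul_of_nonneg_left hcs hq
  linarith

theorem bp_flux (u v : ℂ → ℝ) (bh : ℂ → ℂ) (hb : Sm bh)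
    (hb0 : bh 0 ≠ 0)
    (h : ∀ z : ℂ, z ≠ 0 → (⟨u z, v z⟩ : ℂ) = z⁻¹ ^ 4 * bh z⁻¹) :
    ∃ R0 : ℝ, ∀ z : ℂ, R0 ≤ ‖z‖ →
      u z * fderiv ℝ v z (Complex.I * z) - v z * fderiv ℝ u z (Complex.I * z) < 0 := by
  -- near zero
  set Q : ℂ → ℝ := fun w => 4 * Complex.normSq (bh w) +
    ((starRingEnd ℂ) (bh w) * fderiv ℝ bh w (Complex.I * w)).im with hQ
  have hQc : Continuous Q := by
    have c1 := hb.cont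
    have c2 : Continuous (fderiv ℝ bh) := ContDiff.continuous_fderiv hb (by simp)
    have c3 : Continuous (fun w => fderiv ℝ bh w (Complex.I * w)) :=
      c2.clm_apply (continuous_const.mul continuous_id)
    have c4 : Continuous (fun w => (starRingEnd ℂ) (bh w)) := Complex.continuous_conj.comp c1
    exact (continuous_const.mul (Complex.continuous_normSq.comp c1)).add
      (Complex.continuous_im.comp (c4.mul c3))
  have hQ0 : 0 < Q 0 := by
    simp only [hQ, mul_zero, map_zero, Complex.zero_im, add_zero]
    have := Complex.normSq_pos.2 hb0
    linarith
  obtain ⟨ε, hε, hball⟩ := Metric.eventually_nhds_iff.1 (hQc.continuousAt.eventually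
    (lt_mem_nhds hQ0))
  refine ⟨ε⁻¹ + 1, fun z hz => ?_⟩
  have hz0 : 0 < ‖z‖ := lt_of_lt_of_le (by positivity) hz
  have hzne : z ≠ 0 := norm_pos_iff.1 hz0
  have hw : 0 < Q z⁻¹ := by
    apply hball
    rw [dist_zero_right, norm_inv]
    rw [inv_lt_comm₀ hz0 hε]
    linarith
  set bb : ℂ → ℂ := fun z => z⁻¹ ^ 4 * bh z⁻¹ with hbb
  have heq : (fun z => (⟨u z, v z⟩ : ℂ)) =ᶠ[nhds z] bb := by
    filter_upwards [isOpen_ne.mem_nhds hzne] with y hy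
    exact h y hy
  have hueq : u =ᶠ[nhds z] fun z => (bb z).re := by
    filter_upwards [heq] with y hy
    rw [← hy]
  have hveq : v =ᶠ[nhds z] fun z => (bb z).im := by
    filter_upwards [heq] with y hy
    rw [← hy]
  have hinv : HasFDerivAt (fun z : ℂ => z⁻¹) _ z :=
    ((hasDerivAt_inv hzne).hasFDerivAt.restrictScalars ℝ)
  have hpow : HasFDerivAt (fun z : ℂ => z⁻¹ ^ 4) _ z :=
    ((((hasDerivAt_inv hzne).pow 4).hasFDerivAt).restrictScalars ℝ)
  have hcomp := (hb.diff z⁻¹).hasFDerivAt.comp z hinv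
  have hfull := hpow.mul hcomp
  have hbd : HasFDerivAt bb _ z := hfull
  have hbI : fderiv ℝ bb z (Complex.I * z) =
      -(z⁻¹ ^ 4 * (4 * Complex.I * bh z⁻¹ + fderiv ℝ bh z⁻¹ (Complex.I * z⁻¹))) := by
    rw [hbd.fderiv]
    have e1 : (Complex.I * z * -(z ^ 2)⁻¹) = -(Complex.I * z⁻¹) := by
      field_simp
    simp [e1]
    field_simp
    ring
  have hre : fderiv ℝ u z (Complex.I * z) = (fderiv ℝ bb z (Complex.I * z)).re := by
    rw [hueq.fderiv_eq]
    have := (Complex.reCLM.hasFDerivAt.comp z hbd.differentiableAt.hasFDerivAt).fderiv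
    rw [show (fun z => (bb z).re) = Complex.reCLM ∘ bb from rfl, this]; rfl
  have him : fderiv ℝ v z (Complex.I * z) = (fderiv ℝ bb z (Complex.I * z)).im := by
    rw [hveq.fderiv_eq]
    have := (Complex.imCLM.hasFDerivAt.comp z hbd.differentiableAt.hasFDerivAt).fderiv
    rw [show (fun z => (bb z).im) = Complex.imCLM ∘ bb from rfl, this]; rfl
  rw [hre, him, hueq.self_of_nhds, hveq.self_of_nhds, hbI]
  have hn : 0 < Complex.normSq (z⁻¹ ^ 4) := Complex.normSq_pos.2 (pow_ne_zero _ (inv_ne_zero hzne))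
  have key : (bb z).re * (-(z⁻¹ ^ 4 * (4 * Complex.I * bh z⁻¹ +
      fderiv ℝ bh z⁻¹ (Complex.I * z⁻¹)))).im - (bb z).im * (-(z⁻¹ ^ 4 * (4 * Complex.I * bh z⁻¹ +
      fderiv ℝ bh z⁻¹ (Complex.I * z⁻¹)))).re = -(Complex.normSq (z⁻¹ ^ 4) * Q z⁻¹) := by
    simp only [hbb, hQ]
    generalize z⁻¹ ^ 4 = W
    generalize fderiv ℝ bh z⁻¹ (Complex.I * z⁻¹) = D
    generalize bh z⁻¹ = β
    simp [Complex.normSq_apply]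
    ring
  rw [key]
  have := mul_pos hn hw
  linarith

/-! ### Linear algebra in `E3` -/

theorem bp_inner (a b : E3) : ⟪a, b⟫ = a 0 * b 0 + a 1 * b 1 + a 2 * b 2 := by
  simp [PiLp.inner_apply, Fin.sum_univ_three]; ring

theorem bp_perp_zero (x y n w : E3) (hnx : ⟪n, x⟫ = 0) (hny : ⟪n, y⟫ = 0) (hnn : 0 < ⟪n, n⟫)
    (hW : 0 < ⟪x, x⟫ * ⟪y, y⟫ - ⟪x, y⟫ ^ 2) (h1 : ⟪w, x⟫ = 0) (h2 : ⟪w, y⟫ = 0)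
    (h3 : ⟪w, n⟫ = 0) : w = 0 := by
  set D : ℝ := x 0 * (y 1 * n 2 - y 2 * n 1) - x 1 * (y 0 * n 2 - y 2 * n 0)
    + x 2 * (y 0 * n 1 - y 1 * n 0) with hD
  have hDsq : D ^ 2 = (⟪x, x⟫ * ⟪y, y⟫ - ⟪x, y⟫ ^ 2) * ⟪n, n⟫
      - ⟪x, x⟫ * ⟪n, y⟫ ^ 2 - ⟪y, y⟫ * ⟪n, x⟫ ^ 2 + 2 * ⟪x, y⟫ * ⟪n, x⟫ * ⟪n, y⟫ := by
    simp only [bp_inner, hD]; ring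
  rw [hnx, hny] at hDsq
  have hD0 : D ≠ 0 := by
    intro h
    rw [h] at hDsq
    have := mul_pos hW hnn
    nlinarith
  rw [bp_inner] at h1 h2 h3
  ext i
  have : D * w i = 0 := by
    fin_cases i
    · show D * w 0 = 0
      rw [hD]
      linear_combination (y 1 * n 2 - y 2 * n 1) * h1 + (n 1 * x 2 - n 2 * x 1) * h2
        + (x 1 * y 2 - x 2 * y 1) * h3
    · show D * w 1 = 0
      rw [hD]
      linear_combination (y 2 * n 0 - y 0 * n 2) * h1 + (n 2 * x 0 - n 0 * x 2) * h2
        + (x 2 * y 0 - x 0 * y 2) * h3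
    · show D * w 2 = 0
      rw [hD]
      linear_combination (y 0 * n 1 - y 1 * n 0) * h1 + (n 0 * x 1 - n 1 * x 0) * h2
        + (x 0 * y 1 - x 1 * y 0) * h3
  simpa [hD0] using this

theorem bp_gram (x y n a c : E3) (hnx : ⟪n, x⟫ = 0) (hny : ⟪n, y⟫ = 0) (hnn : ⟪n, n⟫ = 1)
    (hna : ⟪a, n⟫ = 0) (hW : 0 < ⟪x, x⟫ * ⟪y, y⟫ - ⟪x, y⟫ ^ 2) :
    (⟪x, x⟫ * ⟪y, y⟫ - ⟪x, y⟫ ^ 2) * ⟪a, c⟫ =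
      ⟪y, y⟫ * ⟪a, x⟫ * ⟪c, x⟫ - ⟪x, y⟫ * (⟪a, x⟫ * ⟪c, y⟫ + ⟪a, y⟫ * ⟪c, x⟫)
        + ⟪x, x⟫ * ⟪a, y⟫ * ⟪c, y⟫ := by
  set w : E3 := (⟪x, x⟫ * ⟪y, y⟫ - ⟪x, y⟫ ^ 2) • a
    - (⟪y, y⟫ * ⟪a, x⟫ - ⟪x, y⟫ * ⟪a, y⟫) • x
    - (⟪x, x⟫ * ⟪a, y⟫ - ⟪x, y⟫ * ⟪a, x⟫) • y with hw
  have hw0 : w = 0 := by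
    apply bp_perp_zero x y n w hnx hny (by rw [hnn]; exact one_pos) hW
    · simp only [hw, inner_sub_left, real_inner_smul_left, real_inner_comm x y]; ring
    · simp only [hw, inner_sub_left, real_inner_smul_left, real_inner_comm x y]; ring
    · simp only [hw, inner_sub_left, real_inner_smul_left]
      rw [hna, real_inner_comm n x, hnx, real_inner_comm n y, hny]; ring
  have h : ⟪w, c⟫ = 0 := by rw [hw0]; simp
  simp only [hw, inner_sub_left, real_inner_smul_left] at h
  rw [real_inner_comm x c, real_inner_comm y c]
  linear_combination h

def bp_cross (a b : E3) : E3 :=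
  !₂[a 1 * b 2 - a 2 * b 1, a 2 * b 0 - a 0 * b 2, a 0 * b 1 - a 1 * b 0]

theorem bp_cross_left (a b : E3) : ⟪bp_cross a b, a⟫ = 0 := by
  rw [bp_inner]; simp [bp_cross]; ring

theorem bp_cross_right (a b : E3) : ⟪bp_cross a b, b⟫ = 0 := by
  rw [bp_inner]; simp [bp_cross]; ring

theorem bp_cross_sq (a b : E3) :
    ⟪bp_cross a b, bp_cross a b⟫ = ⟪a, a⟫ * ⟪b, b⟫ - ⟪a, b⟫ ^ 2 := by
  simp only [bp_inner]; simp [bp_cross]; ring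

theorem Sm.coord {f : ℂ → E3} (hf : Sm f) (i : Fin 3) : Sm (fun z => f z i) :=
  (contDiff_euclidean.1 hf) i

theorem Sm.mul {f g : ℂ → ℝ} (hf : Sm f) (hg : Sm g) : Sm (fun z => f z * g z) :=
  ContDiff.mul hf hg
theorem Sm.add {f g : ℂ → ℝ} (hf : Sm f) (hg : Sm g) : Sm (fun z => f z + g z) :=
  ContDiff.add hf hg
theorem Sm.sub {f g : ℂ → ℝ} (hf : Sm f) (hg : Sm g) : Sm (fun z => f z - g z) :=
  ContDiff.sub hf hg
theorem Sm.const (c : ℝ) : Sm (fun _ => c) := contDiff_const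
theorem Sm.div {f g : ℂ → ℝ} (hf : Sm f) (hg : Sm g) (h : ∀ z, g z ≠ 0) :
    Sm (fun z => f z / g z) := ContDiff.div hf hg h
theorem Sm.inner {f g : ℂ → E3} (hf : Sm f) (hg : Sm g) : Sm (fun z => ⟪f z, g z⟫) :=
  ContDiff.inner ℝ hf hg

theorem Sm.cross {f g : ℂ → E3} (hf : Sm f) (hg : Sm g) : Sm (fun z => bp_cross (f z) (g z)) := by
  apply contDiff_euclidean.2
  intro i
  fin_cases i
  · exact ((hf.coord 1).mul (hg.coord 2)).sub ((hf.coord 2).mul (hg.coord 1))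
  · exact ((hf.coord 2).mul (hg.coord 0)).sub ((hf.coord 0).mul (hg.coord 2))
  · exact ((hf.coord 0).mul (hg.coord 1)).sub ((hf.coord 1).mul (hg.coord 0))

theorem bp_normal_smooth (x y n : ℂ → E3) (hx : Sm x) (hy : Sm y) (hn : Continuous n)
    (hnx : ∀ z, ⟪n z, x z⟫ = 0) (hny : ∀ z, ⟪n z, y z⟫ = 0) (hnn : ∀ z, ⟪n z, n z⟫ = 1)
    (hW : ∀ z, 0 < ⟪x z, x z⟫ * ⟪y z, y z⟫ - ⟪x z, y z⟫ ^ 2) : Sm n := by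
  set W : ℂ → ℝ := fun z => ⟪x z, x z⟫ * ⟪y z, y z⟫ - ⟪x z, y z⟫ ^ 2 with hWd
  have hWS : Sm W := by
    have h1 := (hx.inner hx).mul (hy.inner hy)
    have h2 := (hx.inner hy).mul (hx.inner hy)
    have := h1.sub h2
    simp only [hWd, sq]; exact this
  set N : ℂ → E3 := fun z => bp_cross (x z) (y z) with hN
  have hNS : Sm N := hx.cross hy
  set c : ℂ → ℝ := fun z => ⟪n z, N z⟫ with hc
  have hdec : ∀ z, n z = (c z / W z) • N z := by
    intro z
    rw [← sub_eq_zero]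
    have hNN : ⟪N z, N z⟫ = W z := bp_cross_sq _ _
    have hWz : 0 < W z := hW z
    apply bp_perp_zero (x z) (y z) (N z) _ (bp_cross_left _ _) (bp_cross_right _ _)
      (by rw [hNN]; exact hWz) (hW z)
    · rw [inner_sub_left, real_inner_smul_left, hnx, bp_cross_left]; simp
    · rw [inner_sub_left, real_inner_smul_left, hny, bp_cross_right]; simp
    · rw [inner_sub_left, real_inner_smul_left, hNN]
      simp only [hc]; field_simp; ring
  have hcsq : ∀ z, c z ^ 2 = W z := by
    intro z
    have hWz : 0 < W z := hW z
    have h := hnn z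
    have hNN : ⟪N z, N z⟫ = W z := bp_cross_sq _ _
    rw [hdec z, real_inner_smul_left, real_inner_smul_right, hNN] at h
    field_simp at h
    exact h
  set d : ℂ → ℝ := fun z => c z / Real.sqrt (W z) with hd
  have hdc : Continuous d := by
    apply Continuous.div
    · exact hn.inner hNS.cont
    · exact Real.continuous_sqrt.comp hWS.cont
    · intro z; exact (Real.sqrt_pos.2 (hW z)).ne'
  have hdsq : Set.EqOn (d ^ 2) 1 Set.univ := by
    intro z _
    have hWz : 0 < W z := hW z
    simp only [hd, Pi.pow_apply, div_pow, hcsq, Real.sq_sqrt hWz.le, Pi.one_apply]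
    field_simp
  have hsqS : Sm (fun z => Real.sqrt (W z)) := ContDiff.sqrt hWS (fun z => (hW z).ne')
  have hfin : ∀ k : ℝ, (∀ z, d z = k) → Sm n := by
    intro k hk
    have : n = fun z => (k * Real.sqrt (W z) / W z) • N z := by
      funext z
      have hs : 0 < Real.sqrt (W z) := Real.sqrt_pos.2 (hW z)
      have : c z = k * Real.sqrt (W z) := by
        rw [← hk z]; exact (div_mul_cancel₀ _ hs.ne').symm
      rw [hdec z, this]
    rw [this]
    exact ContDiff.smul (((Sm.const k).mul hsqS).div hWS (fun z => (hW z).ne')) hNS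
  rcases isPreconnected_univ.eq_one_or_eq_neg_one_of_sq_eq hdc.continuousOn hdsq with h | h
  · exact hfin 1 (fun z => h (Set.mem_univ z))
  · exact hfin (-1) (fun z => h (Set.mem_univ z))

/-! ### Codazzi -/

theorem bp_codazzi (f n : ℂ → E3) (hf : Sm f) (hn : Sm n) (X Y : ℂ)
    (hnx : ∀ z, ⟪n z, pd X f z⟫ = 0) (hny : ∀ z, ⟪n z, pd Y f z⟫ = 0)
    (hnn : ∀ z, ⟪n z, n z⟫ = 1) (E F G L M N : ℂ → ℝ)
    (hE : ∀ z, E z = ⟪pd X f z, pd X f z⟫) (hF : ∀ z, F z = ⟪pd X f z, pd Y f z⟫)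
    (hG : ∀ z, G z = ⟪pd Y f z, pd Y f z⟫)
    (hL : ∀ z, L z = ⟪n z, pd X (pd X f) z⟫) (hM : ∀ z, M z = ⟪n z, pd X (pd Y f) z⟫)
    (hN : ∀ z, N z = ⟪n z, pd Y (pd Y f) z⟫)
    (hW : ∀ z, 0 < E z * G z - F z ^ 2) (z : ℂ) :
    (E z * G z - F z ^ 2) * (pd Y L z - pd X M z) =
      (-(G z * M z * (pd X E z / 2)) + F z * (M z * (pd X F z - pd Y E z / 2) + N z * (pd X E z / 2))
        - E z * N z * (pd X F z - pd Y E z / 2))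
      + (G z * L z * (pd Y E z / 2) - F z * (L z * (pd X G z / 2) + M z * (pd Y E z / 2))
        + E z * M z * (pd X G z / 2)) := by
  obtain rfl : E = _ := funext hE
  obtain rfl : F = _ := funext hF
  obtain rfl : G = _ := funext hG
  obtain rfl : L = _ := funext hL
  obtain rfl : M = _ := funext hM
  obtain rfl : N = _ := funext hN
  have fX := (hf.pd X).diff z
  have fY := (hf.pd Y).diff z
  have fXX := ((hf.pd X).pd X).diff z
  have fXY := ((hf.pd Y).pd X).diff z
  have dn := hn.diff z
  -- derivative relations
  have r1 : ⟪pd X n z, pd X f z⟫ + ⟪n z, pd X (pd X f) z⟫ = 0 := by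
    rw [← pd_inner X dn fX, funext hnx]; simp [pd]
  have r2 : ⟪pd Y n z, pd X f z⟫ + ⟪n z, pd Y (pd X f) z⟫ = 0 := by
    rw [← pd_inner Y dn fX, funext hnx]; simp [pd]
  have r3 : ⟪pd X n z, pd Y f z⟫ + ⟪n z, pd X (pd Y f) z⟫ = 0 := by
    rw [← pd_inner X dn fY, funext hny]; simp [pd]
  have r4 : ⟪pd Y n z, pd Y f z⟫ + ⟪n z, pd Y (pd Y f) z⟫ = 0 := by
    rw [← pd_inner Y dn fY, funext hny]; simp [pd]
  have r5 : ⟪pd X n z, n z⟫ = 0 := by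
    have : ⟪pd X n z, n z⟫ + ⟪n z, pd X n z⟫ = 0 := by
      rw [← pd_inner X dn dn, funext hnn]; simp [pd]
    rw [real_inner_comm (pd X n z) (n z)] at this; linarith
  have r6 : ⟪pd Y n z, n z⟫ = 0 := by
    have : ⟪pd Y n z, n z⟫ + ⟪n z, pd Y n z⟫ = 0 := by
      rw [← pd_inner Y dn dn, funext hnn]; simp [pd]
    rw [real_inner_comm (pd Y n z) (n z)] at this; linarith
  have c1 := pd_comm hf Y X z
  have c2 : pd Y (pd X (pd X f)) z = pd X (pd X (pd Y f)) z := by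
    rw [pd_comm (hf.pd X) Y X z]
    congr 1
    funext w
    exact pd_comm hf Y X w
  rw [pd_inner Y dn fXX, pd_inner X dn fXY, c2]
  have e1 : pd X (fun z => ⟪pd X f z, pd X f z⟫) z = 2 * ⟪pd X (pd X f) z, pd X f z⟫ := by
    rw [pd_inner X fX fX, real_inner_comm (pd X f z)]; ring
  have e2 : pd Y (fun z => ⟪pd X f z, pd X f z⟫) z = 2 * ⟪pd X (pd Y f) z, pd X f z⟫ := by
    rw [pd_inner Y fX fX, c1, real_inner_comm (pd X f z)]; ring
  have e3 : pd X (fun z => ⟪pd X f z, pd Y f z⟫) z =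
      ⟪pd X (pd X f) z, pd Y f z⟫ + ⟪pd X (pd Y f) z, pd X f z⟫ := by
    rw [pd_inner X fX fY, real_inner_comm (pd X f z)]
  have e4 : pd X (fun z => ⟪pd Y f z, pd Y f z⟫) z = 2 * ⟪pd X (pd Y f) z, pd Y f z⟫ := by
    rw [pd_inner X fY fY, real_inner_comm (pd Y f z)]; ring
  rw [e1, e2, e3, e4]
  rw [c1] at r2
  have g1 := bp_gram (pd X f z) (pd Y f z) (n z) (pd Y n z) (pd X (pd X f) z) (hnx z) (hny z)
    (hnn z) r6 (hW z)
  have g2 := bp_gram (pd X f z) (pd Y f z) (n z) (pd X n z) (pd X (pd Y f) z) (hnx z) (hny z)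
    (hnn z) r5 (hW z)
  rw [eq_neg_of_add_eq_zero_left r2, eq_neg_of_add_eq_zero_left r4] at g1
  rw [eq_neg_of_add_eq_zero_left r1, eq_neg_of_add_eq_zero_left r3] at g2
  linear_combination g1 - g2

/-! ### The chart lemma -/

theorem bp_codazzi_diff (f1 n1 f2 n2 : ℂ → E3) (hf1 : Sm f1) (hn1 : Sm n1) (hf2 : Sm f2)
    (hn2 : Sm n2) (X Y : ℂ)
    (hnx1 : ∀ z, ⟪n1 z, pd X f1 z⟫ = 0) (hny1 : ∀ z, ⟪n1 z, pd Y f1 z⟫ = 0)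
    (hnn1 : ∀ z, ⟪n1 z, n1 z⟫ = 1)
    (hnx2 : ∀ z, ⟪n2 z, pd X f2 z⟫ = 0) (hny2 : ∀ z, ⟪n2 z, pd Y f2 z⟫ = 0)
    (hnn2 : ∀ z, ⟪n2 z, n2 z⟫ = 1) (E F G l m n : ℂ → ℝ)
    (hE1 : ∀ z, E z = ⟪pd X f1 z, pd X f1 z⟫) (hF1 : ∀ z, F z = ⟪pd X f1 z, pd Y f1 z⟫)
    (hG1 : ∀ z, G z = ⟪pd Y f1 z, pd Y f1 z⟫)
    (hE2 : ∀ z, E z = ⟪pd X f2 z, pd X f2 z⟫) (hF2 : ∀ z, F z = ⟪pd X f2 z, pd Y f2 z⟫)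
    (hG2 : ∀ z, G z = ⟪pd Y f2 z, pd Y f2 z⟫)
    (hl : ∀ z, l z = ⟪n1 z, pd X (pd X f1) z⟫ - ⟪n2 z, pd X (pd X f2) z⟫)
    (hm : ∀ z, m z = ⟪n1 z, pd X (pd Y f1) z⟫ - ⟪n2 z, pd X (pd Y f2) z⟫)
    (hn : ∀ z, n z = ⟪n1 z, pd Y (pd Y f1) z⟫ - ⟪n2 z, pd Y (pd Y f2) z⟫)
    (hW : ∀ z, 0 < E z * G z - F z ^ 2) (z : ℂ) :
    (E z * G z - F z ^ 2) * (pd Y l z - pd X m z) =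
      (G z * (pd Y E z / 2) - F z * (pd X G z / 2)) * l z
      + (-(G z * (pd X E z / 2)) + F z * (pd X F z - pd Y E z / 2) - F z * (pd Y E z / 2)
        + E z * (pd X G z / 2)) * m z
      + (F z * (pd X E z / 2) - E z * (pd X F z - pd Y E z / 2)) * n z := by
  have c1 := bp_codazzi f1 n1 hf1 hn1 X Y hnx1 hny1 hnn1 E F G _ _ _ hE1 hF1 hG1
    (fun _ => rfl) (fun _ => rfl) (fun _ => rfl) hW z
  have c2 := bp_codazzi f2 n2 hf2 hn2 X Y hnx2 hny2 hnn2 E F G _ _ _ hE2 hF2 hG2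
    (fun _ => rfl) (fun _ => rfl) (fun _ => rfl) hW z
  have dl : pd Y l z = pd Y (fun z => ⟪n1 z, pd X (pd X f1) z⟫) z
      - pd Y (fun z => ⟪n2 z, pd X (pd X f2) z⟫) z := by
    rw [← pd_sub Y ((hn1.inner ((hf1.pd X).pd X)).diff z) ((hn2.inner ((hf2.pd X).pd X)).diff z),
      funext hl]
  have dm : pd X m z = pd X (fun z => ⟪n1 z, pd X (pd Y f1) z⟫) z
      - pd X (fun z => ⟪n2 z, pd X (pd Y f2) z⟫) z := by
    rw [← pd_sub X ((hn1.inner ((hf1.pd Y).pd X)).diff z) ((hn2.inner ((hf2.pd Y).pd X)).diff z),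
      funext hm]
  rw [dl, dm, hl z, hm z, hn z]
  linear_combination c1 - c2

theorem bp_chart (f1 n1 f2 n2 : ℂ → E3) (hf1 : Sm f1) (hn1 : Sm n1) (hf2 : Sm f2)
    (hn2 : Sm n2)
    (hnx1 : ∀ z, ⟪n1 z, pd 1 f1 z⟫ = 0) (hny1 : ∀ z, ⟪n1 z, pd Complex.I f1 z⟫ = 0)
    (hnn1 : ∀ z, ⟪n1 z, n1 z⟫ = 1)
    (hnx2 : ∀ z, ⟪n2 z, pd 1 f2 z⟫ = 0) (hny2 : ∀ z, ⟪n2 z, pd Complex.I f2 z⟫ = 0)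
    (hnn2 : ∀ z, ⟪n2 z, n2 z⟫ = 1) (E F G l m n : ℂ → ℝ)
    (hE1 : ∀ z, E z = ⟪pd 1 f1 z, pd 1 f1 z⟫) (hF1 : ∀ z, F z = ⟪pd 1 f1 z, pd Complex.I f1 z⟫)
    (hG1 : ∀ z, G z = ⟪pd Complex.I f1 z, pd Complex.I f1 z⟫)
    (hE2 : ∀ z, E z = ⟪pd 1 f2 z, pd 1 f2 z⟫) (hF2 : ∀ z, F z = ⟪pd 1 f2 z, pd Complex.I f2 z⟫)
    (hG2 : ∀ z, G z = ⟪pd Complex.I f2 z, pd Complex.I f2 z⟫)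
    (hl : ∀ z, l z = ⟪n1 z, pd 1 (pd 1 f1) z⟫ - ⟪n2 z, pd 1 (pd 1 f2) z⟫)
    (hm : ∀ z, m z = ⟪n1 z, pd 1 (pd Complex.I f1) z⟫ - ⟪n2 z, pd 1 (pd Complex.I f2) z⟫)
    (hn : ∀ z, n z = ⟪n1 z, pd Complex.I (pd Complex.I f1) z⟫
      - ⟪n2 z, pd Complex.I (pd Complex.I f2) z⟫)
    (hW : ∀ z, 0 < E z * G z - F z ^ 2)
    (htr : ∀ z, E z * n z + G z * l z - 2 * F z * m z = 0) :
    Sm (fun z => (l z - n z) / 2) ∧ Sm m ∧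
    (∀ z, (l z - n z) / 2 = 0 → m z = 0 → l z = 0 ∧ n z = 0) ∧
    ∀ R : ℝ, ∃ C : ℝ, ∀ z : ℂ, ‖z‖ ≤ R →
      -C * (((l z - n z) / 2) ^ 2 + (-m z) ^ 2) ≤
        pd 1 (fun z => (l z - n z) / 2) z * pd Complex.I (fun z => -m z) z
          - pd Complex.I (fun z => (l z - n z) / 2) z * pd 1 (fun z => -m z) z := by
  have sE : Sm E := by rw [funext hE1]; exact (hf1.pd _).inner (hf1.pd _)
  have sF : Sm F := by rw [funext hF1]; exact (hf1.pd _).inner (hf1.pd _)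
  have sG : Sm G := by rw [funext hG1]; exact (hf1.pd _).inner (hf1.pd _)
  have sl : Sm l := by
    rw [funext hl]
    exact (hn1.inner ((hf1.pd _).pd _)).sub (hn2.inner ((hf2.pd _).pd _))
  have sm : Sm m := by
    rw [funext hm]
    exact (hn1.inner ((hf1.pd _).pd _)).sub (hn2.inner ((hf2.pd _).pd _))
  have sn : Sm n := by
    rw [funext hn]
    exact (hn1.inner ((hf1.pd _).pd _)).sub (hn2.inner ((hf2.pd _).pd _))
  have sr : Sm (fun z => (l z - n z) / 2) := (sl.sub sn).div (Sm.const 2) (fun _ => two_ne_zero)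
  have hEG : ∀ z, 0 < E z + G z := by
    intro z
    have h1 : 0 ≤ E z := by rw [hE1]; exact real_inner_self_nonneg
    have h2 : 0 ≤ G z := by rw [hG1]; exact real_inner_self_nonneg
    by_contra hh
    have h3 : E z = 0 := by linarith
    have := hW z
    rw [h3] at this
    nlinarith [sq_nonneg (F z)]
  set k1 : ℂ → ℝ := fun z => (E z - G z) / (E z + G z) with hk1
  set k2 : ℂ → ℝ := fun z => 2 * F z / (E z + G z) with hk2
  have s1 : Sm k1 := (sE.sub sG).div (sE.add sG) (fun z => (hEG z).ne')
  have s2 : Sm k2 := ((Sm.const 2).mul sF).div (sE.add sG) (fun z => (hEG z).ne')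
  have ht : ∀ z, (l z + n z) / 2 = k1 z * ((l z - n z) / 2) + k2 z * m z := by
    intro z
    have := (hEG z).ne'
    simp only [hk1, hk2]
    field_simp
    linear_combination 2 * htr z
  refine ⟨sr, sm, ?_, ?_⟩
  · intro z h1 h2
    have := ht z
    rw [h1, h2] at this
    constructor <;> linarith
  have e1 := bp_codazzi_diff f1 n1 f2 n2 hf1 hn1 hf2 hn2 1 Complex.I hnx1 hny1 hnn1 hnx2 hny2 hnn2
    E F G l m n hE1 hF1 hG1 hE2 hF2 hG2 hl hm hn hW
  have e2 := bp_codazzi_diff f1 n1 f2 n2 hf1 hn1 hf2 hn2 Complex.I 1 hny1 hnx1 hnn1 hny2 hnx2 hnn2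
    G F E n m l hG1 (fun z => by rw [hF1, real_inner_comm]) hE1 hG2
    (fun z => by rw [hF2, real_inner_comm]) hE2 hn
    (fun z => by rw [hm, pd_comm hf1, pd_comm hf2]) hl (fun z => by have := hW z; linarith)
  set P : ℂ → ℝ := fun z => (G z * (pd Complex.I E z / 2) - F z * (pd 1 G z / 2)) with hP
  set Q : ℂ → ℝ := fun z => (-(G z * (pd 1 E z / 2)) + F z * (pd 1 F z - pd Complex.I E z / 2)
    - F z * (pd Complex.I E z / 2) + E z * (pd 1 G z / 2)) with hQ
  set S : ℂ → ℝ := fun z => (F z * (pd 1 E z / 2) - E z * (pd 1 F z - pd Complex.I E z / 2)) with hS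
  set P' : ℂ → ℝ := fun z => (E z * (pd 1 G z / 2) - F z * (pd Complex.I E z / 2)) with hP'
  set Q' : ℂ → ℝ := fun z => (-(E z * (pd Complex.I G z / 2))
    + F z * (pd Complex.I F z - pd 1 G z / 2)
    - F z * (pd 1 G z / 2) + G z * (pd Complex.I E z / 2)) with hQ'
  set S' : ℂ → ℝ := fun z => (F z * (pd Complex.I G z / 2)
    - G z * (pd Complex.I F z - pd 1 G z / 2)) with hS'
  have cE := sE.cont
  have cF := sF.cont
  have cG := sG.cont
  have cE1 := (sE.pd 1).cont
  have cF1 := (sF.pd 1).cont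
  have cG1 := (sG.pd 1).cont
  have cEI := (sE.pd Complex.I).cont
  have cFI := (sF.pd Complex.I).cont
  have cGI := (sG.pd Complex.I).cont
  have cP : Continuous P := by fun_prop
  have cQ : Continuous Q := by fun_prop
  have cS : Continuous S := by fun_prop
  have cP' : Continuous P' := by fun_prop
  have cQ' : Continuous Q' := by fun_prop
  have cS' : Continuous S' := by fun_prop
  set V : ℂ → ℝ := fun z => (E z * G z - F z ^ 2)⁻¹ with hV
  have cV : Continuous V := Continuous.inv₀ (by fun_prop) (fun z => (hW z).ne')
  have ck1 := s1.cont
  have ck2 := s2.cont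
  have hVW : ∀ z, V z * (E z * G z - F z ^ 2) = 1 := fun z => inv_mul_cancel₀ (hW z).ne'
  have dt : ∀ X z, pd X (fun z => k1 z * ((l z - n z) / 2) + k2 z * m z) z =
      (pd X l z + pd X n z) / 2 := by
    intro X z
    have : (fun z => k1 z * ((l z - n z) / 2) + k2 z * m z) = fun z => (l z + n z) * 2⁻¹ := by
      funext z; rw [← ht z]; ring
    rw [this, pd_mul X ((sl.diff z).fun_add (sn.diff z)) (differentiableAt_const _),
      pd_add X (sl.diff z) (sn.diff z)]
    simp [pd]; ring
  have dr : ∀ X z, pd X (fun z => (l z - n z) / 2) z = (pd X l z - pd X n z) / 2 := by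
    intro X z
    have : (fun z => (l z - n z) / 2) = fun z => (l z - n z) * 2⁻¹ := by
      funext z; ring
    rw [this, pd_mul X ((sl.diff z).fun_sub (sn.diff z)) (differentiableAt_const _),
      pd_sub X (sl.diff z) (sn.diff z)]
    simp [pd]; ring
  refine bp_elliptic (fun z => (l z - n z) / 2) m k1 k2
    (fun z => V z * (P z * (k1 z + 1) + S z * (k1 z - 1)))
    (fun z => V z * (P z * k2 z + Q z + S z * k2 z))
    (fun z => -(V z * (P' z * (k1 z - 1) + S' z * (k1 z + 1))))
    (fun z => -(V z * (P' z * k2 z + Q' z + S' z * k2 z))) sr sm s1 s2 (by fun_prop) (by fun_prop)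
    (by fun_prop) (by fun_prop) ?_ ?_ ?_
  · intro z
    have h := hEG z
    simp only [hk1, hk2, div_pow]
    rw [← add_div, div_lt_one (by positivity)]
    nlinarith [hW z]
  · intro z
    rw [dt, dr]
    have h1 := e1 z
    have h2 := ht z
    have h3 := hVW z
    linear_combination V z * h1 - (pd Complex.I l z - pd 1 m z) * h3 + V z * (P z + S z) * h2
  · intro z
    rw [dt, dr]
    have h1 := e2 z
    have h2 := ht z
    have h3 := hVW z
    linear_combination -V z * h1 + (pd 1 n z - pd Complex.I m z) * h3 - V z * (P' z + S' z) * h2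

/-! ### Second fundamental form in a conformal chart of the sphere -/

theorem bp_sff_eq (F : E3 → E3) (hF : ContDiff ℝ (⊤ : ℕ∞) F) (x ν v w : E3) :
    sff F x ν v w = ⟪ν, fderiv ℝ (fderiv ℝ F) x w v⟫ - ⟪v, w⟫ * ⟪ν, dF F x x⟫ := by
  unfold sff
  have hd : DifferentiableAt ℝ (fderiv ℝ F) x :=
    ((hF.fderiv_right (m := (⊤ : ℕ∞)) (by simp)).differentiable (by simp)) x
  have : fderiv ℝ (fun y => fderiv ℝ F y v) x w = fderiv ℝ (fderiv ℝ F) x w v := by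
    rw [fderiv_clm_apply hd (differentiableAt_const v)]
    simp
  rw [this, inner_sub_right, real_inner_smul_right]

theorem bp_sff_comb (F : E3 → E3) (hF : ContDiff ℝ (⊤ : ℕ∞) F) (x ν v w : E3) (a b c d : ℝ) :
    sff F x ν (a • v + b • w) (c • v + d • w) =
      a * c * sff F x ν v v + (a * d + b * c) * sff F x ν v w + b * d * sff F x ν w w := by
  have h : IsSymmSndFDerivAt ℝ F x :=
    (ContDiff.contDiffAt hF).isSymmSndFDerivAt (by
      rw [minSmoothness_of_isRCLikeNormedField]; exact WithTop.coe_le_coe.2 le_top)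
  have hs := h.eq v w
  simp only [bp_sff_eq F hF, map_add, map_smul, ContinuousLinearMap.add_apply,
    ContinuousLinearMap.smul_apply, inner_add_left, inner_add_right, real_inner_smul_left,
    real_inner_smul_right, hs, real_inner_comm v w]
  ring

theorem bp_pd_comp (F : E3 → E3) (hF : ContDiff ℝ (⊤ : ℕ∞) F) (Ψ : ℂ → E3) (hΨ : Sm Ψ)
    (X z : ℂ) : pd X (fun z => F (Ψ z)) z = dF F (Ψ z) (pd X Ψ z) := by
  unfold pd dF
  have h1 : DifferentiableAt ℝ F (Ψ z) := hF.differentiable (by simp) _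
  have := (h1.hasFDerivAt.comp z (hΨ.diff z).hasFDerivAt).fderiv
  change fderiv ℝ (F ∘ Ψ) z X = _
  rw [this]; rfl

theorem bp_pd_clm (A : ℂ → E3 →L[ℝ] E3) (u : ℂ → E3) (z X : ℂ) (hA : DifferentiableAt ℝ A z)
    (hu : DifferentiableAt ℝ u z) :
    pd X (fun z => A z (u z)) z = (fderiv ℝ A z X) (u z) + A z (pd X u z) := by
  unfold pd
  rw [fderiv_clm_apply hA hu]
  simp [add_comm]

theorem bp_pd_pd_comp (F : E3 → E3) (hF : ContDiff ℝ (⊤ : ℕ∞) F) (Ψ : ℂ → E3) (hΨ : Sm Ψ)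
    (X Y z : ℂ) : pd X (pd Y (fun z => F (Ψ z))) z =
      fderiv ℝ (fderiv ℝ F) (Ψ z) (pd X Ψ z) (pd Y Ψ z) + dF F (Ψ z) (pd X (pd Y Ψ) z) := by
  have hd : Differentiable ℝ (fderiv ℝ F) :=
    ((hF.fderiv_right (m := (⊤ : ℕ∞)) (by simp)).differentiable (by simp))
  have : pd Y (fun z => F (Ψ z)) = fun z => (fderiv ℝ F (Ψ z)) (pd Y Ψ z) :=
    funext fun z => bp_pd_comp F hF Ψ hΨ Y z
  rw [this, bp_pd_clm (fun z => fderiv ℝ F (Ψ z)) (pd Y Ψ) z X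
    ((hd (Ψ z)).comp z (hΨ.diff z)) ((hΨ.pd Y).diff z)]
  have h2 := ((hd (Ψ z)).hasFDerivAt.comp z (hΨ.diff z).hasFDerivAt).fderiv
  change (fderiv ℝ (fderiv ℝ F ∘ Ψ) z X) _ + _ = _
  rw [h2]; rfl

theorem bp_sff_chart (F : E3 → E3) (hF : ContDiff ℝ (⊤ : ℕ∞) F) (Ψ : ℂ → E3) (hΨ : Sm Ψ)
    (hS : ∀ z, ⟪Ψ z, Ψ z⟫ = 1) (hT : ∀ X z, ⟪Ψ z, pd X Ψ z⟫ = 0) (ν : E3) (z : ℂ)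
    (hν : IsUnitNormalAt F (Ψ z) ν) (X Y : ℂ) :
    ⟪ν, pd X (pd Y (fun z => F (Ψ z))) z⟫ = sff F (Ψ z) ν (pd Y Ψ z) (pd X Ψ z) := by
  have h1 : ⟪pd X Ψ z, pd Y Ψ z⟫ + ⟪Ψ z, pd X (pd Y Ψ) z⟫ = 0 := by
    rw [← pd_inner X (hΨ.diff z) ((hΨ.pd Y).diff z), funext (hT Y)]; simp [pd]
  have h2 := hν.2 (pd X (pd Y Ψ) z + ⟪pd Y Ψ z, pd X Ψ z⟫ • Ψ z) (by
    unfold Tang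
    rw [inner_add_right, real_inner_smul_right, hS, real_inner_comm (pd X Ψ z)]
    linarith)
  rw [map_add, map_smul, inner_add_right, real_inner_smul_right] at h2
  rw [bp_pd_pd_comp F hF Ψ hΨ, bp_sff_eq F hF, inner_add_right]
  linarith

theorem bp_immersion_W (F : E3 → E3) (x u v : E3) (hx : x ∈ S2)
    (hF : IsImmersionOnSphere F) (hu : Tang x u) (hv : Tang x v) (huv : ⟪u, v⟫ = 0)
    (huu : 0 < ⟪u, u⟫) (hvv : 0 < ⟪v, v⟫) :
    0 < ⟪dF F x u, dF F x u⟫ * ⟪dF F x v, dF F x v⟫ - ⟪dF F x u, dF F x v⟫ ^ 2 := by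
  have hu0 : u ≠ 0 := by rintro rfl; simp at huu
  have hE : 0 < ⟪dF F x u, dF F x u⟫ := real_inner_self_pos.2 (hF.2 x hx u hu hu0)
  set a := ⟪dF F x u, dF F x u⟫ with ha
  set b := ⟪dF F x u, dF F x v⟫ with hb
  have ht : Tang x (b • u - a • v) := by
    unfold Tang at *
    rw [inner_sub_right, real_inner_smul_right, real_inner_smul_right, hu, hv]; simp
  have h0 : b • u - a • v ≠ 0 := by
    intro h
    have h1 : ⟪b • u - a • v, v⟫ = 0 := by rw [h]; simp
    rw [inner_sub_left, real_inner_smul_left, real_inner_smul_left, huv] at h1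
    nlinarith [mul_pos hE hvv]
  have hp := real_inner_self_pos.2 (hF.2 x hx _ ht h0)
  rw [map_sub, map_smul, map_smul, inner_sub_left, inner_sub_right, inner_sub_right,
    real_inner_smul_left, real_inner_smul_left, real_inner_smul_left, real_inner_smul_left,
    real_inner_smul_right, real_inner_smul_right, real_inner_smul_right, real_inner_smul_right,
    real_inner_comm (dF F x u) (dF F x v), ← ha, ← hb] at hp
  have : 0 < a * (a * ⟪dF F x v, dF F x v⟫ - b ^ 2) := by linarith
  exact pos_of_mul_pos_right this hE.le

/-- Difference of second fundamental forms. -/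
def bp_Q (F₁ F₂ ν₁ ν₂ : E3 → E3) (x v w : E3) : ℝ :=
  sff F₁ x (ν₁ x) v w - sff F₂ x (ν₂ x) v w

theorem bp_mem_S2 (x : E3) : x ∈ S2 ↔ ⟪x, x⟫ = 1 := by
  unfold S2
  rw [mem_sphere_zero_iff_norm, real_inner_self_eq_norm_sq]
  constructor
  · intro h; rw [h]; norm_num
  · intro h; nlinarith [norm_nonneg x]

theorem bp_conformal
    (F₁ F₂ : E3 → E3) (ν₁ ν₂ : E3 → E3) (H : E3 → ℝ)
    (h₁ : IsImmersionOnSphere F₁) (h₂ : IsImmersionOnSphere F₂)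
    (hν₁ : Continuous ν₁) (hν₂ : Continuous ν₂)
    (hmet : ∀ x ∈ S2, ∀ v w : E3, Tang x v → Tang x w →
      inducedMetric F₁ x v w = inducedMetric F₂ x v w)
    (hH₁ : ∀ x ∈ S2, IsMeanCurvAt F₁ x (ν₁ x) (H x))
    (hH₂ : ∀ x ∈ S2, IsMeanCurvAt F₂ x (ν₂ x) (H x))
    (Ψ : ℂ → E3) (hΨ : Sm Ψ) (hS : ∀ z, ⟪Ψ z, Ψ z⟫ = 1) (c : ℂ → ℝ) (hc : ∀ z, 0 < c z)
    (h11 : ∀ z, ⟪pd 1 Ψ z, pd 1 Ψ z⟫ = c z) (hII : ∀ z, ⟪pd Complex.I Ψ z, pd Complex.I Ψ z⟫ = c z)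
    (h1I : ∀ z, ⟪pd 1 Ψ z, pd Complex.I Ψ z⟫ = 0) (l m n : ℂ → ℝ)
    (hl : l = fun z => bp_Q F₁ F₂ ν₁ ν₂ (Ψ z) (pd 1 Ψ z) (pd 1 Ψ z))
    (hm : m = fun z => bp_Q F₁ F₂ ν₁ ν₂ (Ψ z) (pd 1 Ψ z) (pd Complex.I Ψ z))
    (hn : n = fun z => bp_Q F₁ F₂ ν₁ ν₂ (Ψ z) (pd Complex.I Ψ z) (pd Complex.I Ψ z)) :
    Sm (fun z => (l z - n z) / 2) ∧ Sm m ∧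
    (∀ z, (l z - n z) / 2 = 0 → m z = 0 → l z = 0 ∧ n z = 0) ∧
    ∀ R : ℝ, ∃ C : ℝ, ∀ z : ℂ, ‖z‖ ≤ R →
      -C * (((l z - n z) / 2) ^ 2 + (-m z) ^ 2) ≤
        pd 1 (fun z => (l z - n z) / 2) z * pd Complex.I (fun z => -m z) z
          - pd Complex.I (fun z => (l z - n z) / 2) z * pd 1 (fun z => -m z) z := by
  have hT : ∀ X z, ⟪Ψ z, pd X Ψ z⟫ = 0 := by
    intro X z
    have : ⟪pd X Ψ z, Ψ z⟫ + ⟪Ψ z, pd X Ψ z⟫ = 0 := by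
      rw [← pd_inner X (hΨ.diff z) (hΨ.diff z), funext hS]; simp [pd]
    rw [real_inner_comm (Ψ z)] at this; linarith
  have hmem : ∀ z, Ψ z ∈ S2 := fun z => (bp_mem_S2 _).2 (hS z)
  have key : ∀ F ν : E3 → E3, IsImmersionOnSphere F → Continuous ν →
      (∀ x ∈ S2, IsMeanCurvAt F x (ν x) (H x)) →
      Sm (fun z => F (Ψ z)) ∧ Sm (fun z => ν (Ψ z)) ∧
      (∀ X z, ⟪ν (Ψ z), pd X (fun z => F (Ψ z)) z⟫ = 0) ∧ (∀ z, ⟪ν (Ψ z), ν (Ψ z)⟫ = 1) ∧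
      (∀ z, 0 < inducedMetric F (Ψ z) (pd 1 Ψ z) (pd 1 Ψ z) *
        inducedMetric F (Ψ z) (pd Complex.I Ψ z) (pd Complex.I Ψ z) -
        inducedMetric F (Ψ z) (pd 1 Ψ z) (pd Complex.I Ψ z) ^ 2) := by
    intro F ν hF hν hH
    have sf : Sm (fun z => F (Ψ z)) := ContDiff.comp hF.1 hΨ
    have hperp : ∀ X z, ⟪ν (Ψ z), pd X (fun z => F (Ψ z)) z⟫ = 0 := by
      intro X z
      rw [bp_pd_comp F hF.1 Ψ hΨ]
      exact (hH _ (hmem z)).1.2 _ (hT X z)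
    have hnn : ∀ z, ⟪ν (Ψ z), ν (Ψ z)⟫ = 1 := by
      intro z
      rw [real_inner_self_eq_norm_sq, (hH _ (hmem z)).1.1]; norm_num
    have hW : ∀ z, 0 < inducedMetric F (Ψ z) (pd 1 Ψ z) (pd 1 Ψ z) *
        inducedMetric F (Ψ z) (pd Complex.I Ψ z) (pd Complex.I Ψ z) -
        inducedMetric F (Ψ z) (pd 1 Ψ z) (pd Complex.I Ψ z) ^ 2 := fun z =>
      bp_immersion_W F (Ψ z) _ _ (hmem z) hF (hT _ z) (hT _ z) (h1I z)
        (by rw [h11]; exact hc z) (by rw [hII]; exact hc z)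
    refine ⟨sf, ?_, hperp, hnn, hW⟩
    refine bp_normal_smooth (pd 1 (fun z => F (Ψ z))) (pd Complex.I (fun z => F (Ψ z)))
      (fun z => ν (Ψ z)) (sf.pd _) (sf.pd _) (hν.comp hΨ.cont) (hperp 1) (hperp _) hnn ?_
    intro z
    simp only [bp_pd_comp F hF.1 Ψ hΨ]
    exact hW z
  obtain ⟨sf1, sn1, p1, nn1, W1⟩ := key F₁ ν₁ h₁ hν₁ hH₁
  obtain ⟨sf2, sn2, p2, nn2, W2⟩ := key F₂ ν₂ h₂ hν₂ hH₂
  have hmm : ∀ X Y z, inducedMetric F₁ (Ψ z) (pd X Ψ z) (pd Y Ψ z) =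
      inducedMetric F₂ (Ψ z) (pd X Ψ z) (pd Y Ψ z) := fun X Y z =>
    hmet _ (hmem z) _ _ (hT X z) (hT Y z)
  have i1 : ∀ X Y z, inducedMetric F₁ (Ψ z) (pd X Ψ z) (pd Y Ψ z) =
      ⟪pd X (fun z => F₁ (Ψ z)) z, pd Y (fun z => F₁ (Ψ z)) z⟫ := by
    intro X Y z
    rw [bp_pd_comp F₁ h₁.1 Ψ hΨ, bp_pd_comp F₁ h₁.1 Ψ hΨ]; rfl
  have i2 : ∀ X Y z, inducedMetric F₁ (Ψ z) (pd X Ψ z) (pd Y Ψ z) =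
      ⟪pd X (fun z => F₂ (Ψ z)) z, pd Y (fun z => F₂ (Ψ z)) z⟫ := by
    intro X Y z
    rw [hmm, bp_pd_comp F₂ h₂.1 Ψ hΨ, bp_pd_comp F₂ h₂.1 Ψ hΨ]; rfl
  have q : ∀ X Y z, bp_Q F₁ F₂ ν₁ ν₂ (Ψ z) (pd Y Ψ z) (pd X Ψ z) =
      ⟪ν₁ (Ψ z), pd X (pd Y (fun z => F₁ (Ψ z))) z⟫
        - ⟪ν₂ (Ψ z), pd X (pd Y (fun z => F₂ (Ψ z))) z⟫ := by
    intro X Y z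
    rw [bp_sff_chart F₁ h₁.1 Ψ hΨ hS hT _ z (hH₁ _ (hmem z)).1,
      bp_sff_chart F₂ h₂.1 Ψ hΨ hS hT _ z (hH₂ _ (hmem z)).1]; rfl
  subst hl hm hn
  refine bp_chart (fun z => F₁ (Ψ z)) (fun z => ν₁ (Ψ z)) (fun z => F₂ (Ψ z)) (fun z => ν₂ (Ψ z))
    sf1 sn1 sf2 sn2 (p1 _) (p1 _) nn1 (p2 _) (p2 _) nn2
    (fun z => inducedMetric F₁ (Ψ z) (pd 1 Ψ z) (pd 1 Ψ z))
    (fun z => inducedMetric F₁ (Ψ z) (pd 1 Ψ z) (pd Complex.I Ψ z))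
    (fun z => inducedMetric F₁ (Ψ z) (pd Complex.I Ψ z) (pd Complex.I Ψ z)) _ _ _
    (i1 _ _) (i1 _ _) (i1 _ _) (i2 _ _) (i2 _ _) (i2 _ _) (q _ _)
    (fun z => by
      rw [q, pd_comm sf1, pd_comm sf2]) (q _ _) W1 ?_
  intro z
  -- trace
  set lam : ℝ := (Real.sqrt (c z))⁻¹ with hlam
  have hsq : 0 < Real.sqrt (c z) := Real.sqrt_pos.2 (hc z)
  have hlp : 0 < lam := inv_pos.2 hsq
  have hlc : lam ^ 2 * c z = 1 := by
    rw [hlam, inv_pow, Real.sq_sqrt (hc z).le]; exact inv_mul_cancel₀ (hc z).ne'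
  have hnorm : ∀ X, ⟪pd X Ψ z, pd X Ψ z⟫ = c z → ‖lam • pd X Ψ z‖ = 1 := by
    intro X hX
    have : ‖lam • pd X Ψ z‖ ^ 2 = 1 := by
      rw [← real_inner_self_eq_norm_sq, real_inner_smul_left, real_inner_smul_right, hX, ← hlc]
      ring
    nlinarith [norm_nonneg (lam • pd X Ψ z)]
  have hTl : ∀ X, Tang (Ψ z) (lam • pd X Ψ z) := by
    intro X; unfold Tang; rw [real_inner_smul_right, hT]; simp
  have ho : ⟪lam • pd 1 Ψ z, lam • pd Complex.I Ψ z⟫ = 0 := by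
    rw [real_inner_smul_left, real_inner_smul_right, h1I]; simp
  have t1 := (hH₁ _ (hmem z)).2 _ _ (hTl 1) (hTl Complex.I) ho (hnorm _ (h11 z)) (hnorm _ (hII z))
  have t2 := (hH₂ _ (hmem z)).2 _ _ (hTl 1) (hTl Complex.I) ho (hnorm _ (h11 z)) (hnorm _ (hII z))
  have hg : ∀ (F : E3 → E3) (X Y : ℂ), inducedMetric F (Ψ z) (lam • pd X Ψ z) (lam • pd Y Ψ z) =
      lam ^ 2 * inducedMetric F (Ψ z) (pd X Ψ z) (pd Y Ψ z) := by
    intro F X Y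
    unfold inducedMetric
    rw [map_smul, map_smul, real_inner_smul_left, real_inner_smul_right]; ring
  have hs : ∀ (F : E3 → E3) (_ : ContDiff ℝ (⊤ : ℕ∞) F) (ν : E3) (X Y : ℂ),
      sff F (Ψ z) ν (lam • pd X Ψ z) (lam • pd Y Ψ z) =
      lam ^ 2 * sff F (Ψ z) ν (pd X Ψ z) (pd Y Ψ z) := by
    intro F hF ν X Y
    have := bp_sff_comb F hF (Ψ z) ν (pd X Ψ z) (pd Y Ψ z) lam 0 0 lam
    simp only [zero_smul, add_zero, zero_add] at this
    rw [this]; ring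
  unfold traceFormula at t1 t2
  simp only [hg, hs F₁ h₁.1] at t1
  simp only [hg, hs F₂ h₂.1, ← hmm] at t2
  have hD := W1 z
  set E := inducedMetric F₁ (Ψ z) (pd 1 Ψ z) (pd 1 Ψ z)
  set G := inducedMetric F₁ (Ψ z) (pd Complex.I Ψ z) (pd Complex.I Ψ z)
  set F := inducedMetric F₁ (Ψ z) (pd 1 Ψ z) (pd Complex.I Ψ z)
  have hD' : lam ^ 2 * E * (lam ^ 2 * G) - (lam ^ 2 * F) ^ 2 ≠ 0 := by
    have : lam ^ 2 * E * (lam ^ 2 * G) - (lam ^ 2 * F) ^ 2 = lam ^ 4 * (E * G - F ^ 2) := by ring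
    rw [this]; positivity
  rw [eq_div_iff hD'] at t1 t2
  have hl4 : lam ^ 4 ≠ 0 := by positivity
  apply mul_left_cancel₀ hl4
  simp only [bp_Q]
  linear_combination t2 - t1

/-! ### Stereographic charts -/

def bp_s (z : ℂ) : ℝ := 1 + (z.re * z.re + z.im * z.im)

theorem bp_s_pos (z : ℂ) : 0 < bp_s z := by
  unfold bp_s; nlinarith [mul_self_nonneg z.re, mul_self_nonneg z.im]

def bp_num (e1 e2 p : E3) (z : ℂ) : E3 :=
  (2 * z.re) • e1 + (2 * z.im) • e2 + (bp_s z - 2) • p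

def bp_ster (e1 e2 p : E3) (z : ℂ) : E3 := (bp_s z)⁻¹ • bp_num e1 e2 p z

theorem bp_sm_re : Sm (fun z : ℂ => z.re) := Complex.reCLM.contDiff
theorem bp_sm_im : Sm (fun z : ℂ => z.im) := Complex.imCLM.contDiff

theorem bp_pd_re (X z : ℂ) : pd X (fun z : ℂ => z.re) z = X.re := by
  unfold pd
  change fderiv ℝ (Complex.reCLM) z X = _
  rw [ContinuousLinearMap.fderiv]; rfl
theorem bp_pd_im (X z : ℂ) : pd X (fun z : ℂ => z.im) z = X.im := by
  unfold pd
  change fderiv ℝ (Complex.imCLM) z X = _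
  rw [ContinuousLinearMap.fderiv]; rfl

theorem bp_sm_s : Sm bp_s :=
  (Sm.const 1).add ((bp_sm_re.mul bp_sm_re).add (bp_sm_im.mul bp_sm_im))

theorem bp_pd_s (X z : ℂ) : pd X bp_s z = 2 * (z.re * X.re + z.im * X.im) := by
  have h1 := bp_sm_re.diff z
  have h2 := bp_sm_im.diff z
  have : pd X bp_s z = pd X (fun z : ℂ => 1 + (z.re * z.re + z.im * z.im)) z := rfl
  rw [this, pd_add X (differentiableAt_const _) ((h1.fun_mul h1).fun_add (h2.fun_mul h2)),
    pd_add X (h1.fun_mul h1) (h2.fun_mul h2), pd_mul X h1 h1, pd_mul X h2 h2, bp_pd_re, bp_pd_im]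
  simp [pd]; ring

theorem bp_sm_smul {g : ℂ → ℝ} {f : ℂ → E3} (hg : Sm g) (hf : Sm f) : Sm (fun z => g z • f z) :=
  ContDiff.smul hg hf

theorem bp_sm_addv {g f : ℂ → E3} (hg : Sm g) (hf : Sm f) : Sm (fun z => g z + f z) :=
  ContDiff.add hg hf

theorem bp_sm_constv (v : E3) : Sm (fun _ => v) := contDiff_const

theorem bp_pd_smul {g : ℂ → ℝ} {f : ℂ → E3} (hg : Sm g) (hf : Sm f) (X z : ℂ) :
    pd X (fun z => g z • f z) z = pd X g z • f z + g z • pd X f z := by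
  unfold pd
  rw [fderiv_fun_smul (hg.diff z) (hf.diff z)]
  simp [add_comm]

theorem bp_pd_addv {g f : ℂ → E3} (hg : Sm g) (hf : Sm f) (X z : ℂ) :
    pd X (fun z => g z + f z) z = pd X g z + pd X f z := by
  unfold pd
  rw [fderiv_fun_add (hg.diff z) (hf.diff z)]
  simp

theorem bp_pd_constv (v : E3) (X z : ℂ) : pd X (fun _ => v) z = 0 := by
  simp [pd]

theorem bp_sm_num (e1 e2 p : E3) : Sm (bp_num e1 e2 p) :=
  bp_sm_addv (bp_sm_addv (bp_sm_smul ((Sm.const 2).mul bp_sm_re) (bp_sm_constv e1))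
    (bp_sm_smul ((Sm.const 2).mul bp_sm_im) (bp_sm_constv e2)))
    (bp_sm_smul (bp_sm_s.sub (Sm.const 2)) (bp_sm_constv p))

theorem bp_sm_ster (e1 e2 p : E3) : Sm (bp_ster e1 e2 p) :=
  bp_sm_smul (ContDiff.inv bp_sm_s (fun z => (bp_s_pos z).ne')) (bp_sm_num e1 e2 p)

theorem bp_pd_num (e1 e2 p : E3) (X z : ℂ) : pd X (bp_num e1 e2 p) z =
    (2 * X.re) • e1 + (2 * X.im) • e2 + (pd X bp_s z) • p := by
  have s1 := (Sm.const 2).mul bp_sm_re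
  have s2 := (Sm.const 2).mul bp_sm_im
  have s3 := bp_sm_s.sub (Sm.const 2)
  have c1 := bp_sm_constv e1
  have c2 := bp_sm_constv e2
  have c3 := bp_sm_constv p
  have : pd X (bp_num e1 e2 p) z =
    pd X (fun z => (2 * z.re) • e1 + (2 * z.im) • e2 + (bp_s z - 2) • p) z := rfl
  rw [this, bp_pd_addv (bp_sm_addv (bp_sm_smul s1 c1) (bp_sm_smul s2 c2)) (bp_sm_smul s3 c3),
    bp_pd_addv (bp_sm_smul s1 c1) (bp_sm_smul s2 c2), bp_pd_smul s1 c1, bp_pd_smul s2 c2,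
    bp_pd_smul s3 c3, pd_mul X (differentiableAt_const _) (bp_sm_re.diff z),
    pd_mul X (differentiableAt_const _) (bp_sm_im.diff z),
    pd_sub X (bp_sm_s.diff z) (differentiableAt_const _), bp_pd_re, bp_pd_im,
    bp_pd_constv, bp_pd_constv, bp_pd_constv]
  simp [pd]

theorem bp_num_eq (e1 e2 p : E3) (z : ℂ) : bp_num e1 e2 p z = bp_s z • bp_ster e1 e2 p z := by
  unfold bp_ster
  rw [smul_smul, mul_inv_cancel₀ (bp_s_pos z).ne', one_smul]

theorem bp_pd_ster (e1 e2 p : E3) (X z : ℂ) : pd X (bp_ster e1 e2 p) z =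
    (bp_s z)⁻¹ • ((2 * X.re) • e1 + (2 * X.im) • e2 + (pd X bp_s z) • p
      - pd X bp_s z • bp_ster e1 e2 p z) := by
  have h : pd X (bp_num e1 e2 p) z = pd X bp_s z • bp_ster e1 e2 p z
      + bp_s z • pd X (bp_ster e1 e2 p) z := by
    rw [← bp_pd_smul bp_sm_s (bp_sm_ster e1 e2 p), ← funext (bp_num_eq e1 e2 p)]
  rw [← bp_pd_num, h, add_sub_cancel_left, smul_smul, inv_mul_cancel₀ (bp_s_pos z).ne', one_smul]

theorem bp_ster_inner (e1 e2 p : E3) (h11 : ⟪e1, e1⟫ = 1) (h22 : ⟪e2, e2⟫ = 1) (hpp : ⟪p, p⟫ = 1)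
    (h12 : ⟪e1, e2⟫ = 0) (h1p : ⟪e1, p⟫ = 0) (h2p : ⟪e2, p⟫ = 0) (z : ℂ) :
    ⟪bp_ster e1 e2 p z, bp_ster e1 e2 p z⟫ = 1 ∧
    ∀ X Y, ⟪pd X (bp_ster e1 e2 p) z, pd Y (bp_ster e1 e2 p) z⟫ =
      4 / bp_s z ^ 2 * (X.re * Y.re + X.im * Y.im) := by
  have hs := (bp_s_pos z).ne'
  have h21 : ⟪e2, e1⟫ = 0 := by rw [real_inner_comm, h12]
  have hp1 : ⟪p, e1⟫ = 0 := by rw [real_inner_comm, h1p]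
  have hp2 : ⟪p, e2⟫ = 0 := by rw [real_inner_comm, h2p]
  have hsd : z.re ^ 2 + z.im ^ 2 = bp_s z - 1 := by unfold bp_s; ring
  have a1 : ⟪bp_ster e1 e2 p z, bp_ster e1 e2 p z⟫ = 1 := by
    unfold bp_ster bp_num
    simp only [inner_add_left, inner_add_right, real_inner_smul_left, real_inner_smul_right,
      h11, h22, hpp, h12, h1p, h2p, h21, hp1, hp2]
    field_simp
    linear_combination 4 * hsd
  refine ⟨a1, fun X Y => ?_⟩
  have a2 : ∀ X : ℂ, ⟪(2 * X.re) • e1 + (2 * X.im) • e2 + (pd X bp_s z) • p, bp_ster e1 e2 p z⟫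
      = pd X bp_s z := by
    intro X
    unfold bp_ster bp_num
    simp only [inner_add_left, inner_add_right, real_inner_smul_left, real_inner_smul_right,
      h11, h22, hpp, h12, h1p, h2p, h21, hp1, hp2]
    field_simp
    rw [bp_pd_s]; ring
  have a3 : ⟪(2 * X.re) • e1 + (2 * X.im) • e2 + (pd X bp_s z) • p,
      (2 * Y.re) • e1 + (2 * Y.im) • e2 + (pd Y bp_s z) • p⟫ =
      4 * (X.re * Y.re + X.im * Y.im) + pd X bp_s z * pd Y bp_s z := by
    simp only [inner_add_left, inner_add_right, real_inner_smul_left, real_inner_smul_right,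
      h11, h22, hpp, h12, h1p, h2p, h21, hp1, hp2]
    ring
  rw [bp_pd_ster, bp_pd_ster, real_inner_smul_left, real_inner_smul_right, inner_sub_left,
    inner_sub_right, inner_sub_right, real_inner_smul_left, real_inner_smul_left,
    real_inner_smul_right, real_inner_smul_right, a1, a2, a3,
    real_inner_comm _ (bp_ster e1 e2 p z), a2]
  field_simp
  ring

theorem bp_ster_inv (e1 e2 p : E3) (z : ℂ) (hz : z ≠ 0) :
    bp_ster e1 e2 p z = bp_ster e1 (-e2) (-p) z⁻¹ := by
  have hq : 0 < z.re * z.re + z.im * z.im := Complex.normSq_pos.2 hz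
  have hs := (bp_s_pos z).ne'
  have hq2 : z.re ^ 2 + z.im ^ 2 ≠ 0 := by rw [sq, sq]; exact hq.ne'
  have h1 : bp_s z⁻¹ = bp_s z / (z.re * z.re + z.im * z.im) := by
    unfold bp_s
    rw [Complex.inv_re, Complex.inv_im, Complex.normSq_apply]
    field_simp
    ring
  have hb : z.re ^ 2 + z.im ^ 2 = bp_s z - 1 := by unfold bp_s; ring
  unfold bp_ster bp_num
  rw [h1, Complex.inv_re, Complex.inv_im, Complex.normSq_apply]
  simp only [smul_neg, ← neg_smul, smul_add, smul_smul]
  congr 1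
  · congr 1
    · congr 1; field_simp
    · congr 1; field_simp
  · congr 1; field_simp; rw [hb]; ring

theorem bp_pd_lin (f : ℂ → E3) (a z : ℂ) :
    pd a f z = a.re • pd 1 f z + a.im • pd Complex.I f z := by
  unfold pd
  rw [← map_smul, ← map_smul, ← map_add]
  congr 1
  apply Complex.ext <;> simp

theorem bp_pd_inv (e1 e2 p : E3) (z : ℂ) (hz : z ≠ 0) (X : ℂ) :
    pd X (bp_ster e1 e2 p) z = pd (-(z⁻¹ ^ 2) * X) (bp_ster e1 (-e2) (-p)) z⁻¹ := by
  have h1 : HasFDerivAt (fun z : ℂ => z⁻¹)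
      ((ContinuousLinearMap.toSpanSingleton ℂ (-(z ^ 2)⁻¹)).restrictScalars ℝ) z :=
    (hasDerivAt_inv hz).hasFDerivAt.restrictScalars ℝ
  have h2 := ((bp_sm_ster e1 (-e2) (-p)).diff z⁻¹).hasFDerivAt
  have h3 := h2.comp z h1
  have h4 : bp_ster e1 e2 p =ᶠ[nhds z] (bp_ster e1 (-e2) (-p)) ∘ (fun z : ℂ => z⁻¹) := by
    filter_upwards [isOpen_ne.mem_nhds hz] with w hw
    exact bp_ster_inv e1 e2 p w hw
  unfold pd
  rw [(h3.congr_of_eventuallyEq h4).fderiv]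
  simp only [ContinuousLinearMap.comp_apply]
  congr 1
  simp [mul_comm]

theorem bp_exists_frame (p : E3) (hp : ⟪p, p⟫ = 1) : ∃ e1 e2 : E3,
    ⟪e1, e1⟫ = 1 ∧ ⟪e2, e2⟫ = 1 ∧ ⟪e1, e2⟫ = 0 ∧ ⟪e1, p⟫ = 0 ∧ ⟪e2, p⟫ = 0 := by
  obtain ⟨a, ha⟩ : ∃ a : E3, bp_cross p a ≠ 0 := by
    by_contra h
    push Not at h
    have h1 := bp_cross_sq p (EuclideanSpace.single 0 1)
    have h2 := bp_cross_sq p (EuclideanSpace.single 1 1)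
    have h3 := bp_cross_sq p (EuclideanSpace.single 2 1)
    rw [h, hp] at h1 h2 h3
    simp only [bp_inner] at h1 h2 h3 hp
    simp at h1 h2 h3
    nlinarith
  set c := bp_cross p a with hc
  have hcc : 0 < ⟪c, c⟫ := real_inner_self_pos.2 ha
  set t := (Real.sqrt ⟪c, c⟫)⁻¹ with ht
  have htt : t * (t * ⟪c, c⟫) = 1 := by
    rw [← mul_assoc, ← sq, ht, inv_pow, Real.sq_sqrt hcc.le]; exact inv_mul_cancel₀ hcc.ne'
  have e11 : ⟪t • c, t • c⟫ = 1 := by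
    rw [real_inner_smul_left, real_inner_smul_right, htt]
  have e1p : ⟪t • c, p⟫ = 0 := by
    rw [real_inner_smul_left, hc, bp_cross_left]; simp
  refine ⟨t • c, bp_cross (t • c) p, e11, ?_, ?_, e1p, bp_cross_right _ _⟩
  · rw [bp_cross_sq, e11, hp, e1p]; norm_num
  · rw [real_inner_comm, bp_cross_left]

theorem bp_decomp (e1 e2 p v : E3) (h11 : ⟪e1, e1⟫ = 1) (h22 : ⟪e2, e2⟫ = 1) (hpp : ⟪p, p⟫ = 1)
    (h12 : ⟪e1, e2⟫ = 0) (h1p : ⟪e1, p⟫ = 0) (h2p : ⟪e2, p⟫ = 0) (hv : ⟪p, v⟫ = 0) :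
    v = ⟪v, e1⟫ • e1 + ⟪v, e2⟫ • e2 := by
  rw [← sub_eq_zero]
  apply bp_perp_zero e1 e2 p _ (by rw [real_inner_comm, h1p]) (by rw [real_inner_comm, h2p])
    (by rw [hpp]; norm_num) (by rw [h11, h22, h12]; norm_num)
  · rw [inner_sub_left, inner_add_left, real_inner_smul_left, real_inner_smul_left, h11,
      real_inner_comm e1 e2, h12]; ring
  · rw [inner_sub_left, inner_add_left, real_inner_smul_left, real_inner_smul_left, h22, h12]; ring
  · rw [inner_sub_left, inner_add_left, real_inner_smul_left, real_inner_smul_left, h1p, h2p,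
      real_inner_comm p v, hv]; ring

theorem bp_Q_comb (F₁ F₂ ν₁ ν₂ : E3 → E3) (hF₁ : ContDiff ℝ (⊤ : ℕ∞) F₁)
    (hF₂ : ContDiff ℝ (⊤ : ℕ∞) F₂) (x v w : E3) (a b c d : ℝ) :
    bp_Q F₁ F₂ ν₁ ν₂ x (a • v + b • w) (c • v + d • w) =
      a * c * bp_Q F₁ F₂ ν₁ ν₂ x v v + (a * d + b * c) * bp_Q F₁ F₂ ν₁ ν₂ x v w
        + b * d * bp_Q F₁ F₂ ν₁ ν₂ x w w := by
  unfold bp_Q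
  rw [bp_sff_comb F₁ hF₁, bp_sff_comb F₂ hF₂]; ring

/-- Let `F₁, F₂ : S² → ℝ³` be smooth immersions inducing the same metric
`γ` and the same mean curvature `H` (with respect to unit normal fields `ν₁, ν₂`). Then
their second fundamental forms are equal: `A₁ = A₂`. -/
theorem bonnet_pair_same_second_fundamental_form
    (F₁ F₂ : E3 → E3) (ν₁ ν₂ : E3 → E3) (H : E3 → ℝ)
    (h₁ : IsImmersionOnSphere F₁) (h₂ : IsImmersionOnSphere F₂)
    (hν₁ : Continuous ν₁) (hν₂ : Continuous ν₂)
    (hmet : ∀ x ∈ S2, ∀ v w : E3, Tang x v → Tang x w →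
      inducedMetric F₁ x v w = inducedMetric F₂ x v w)
    (hH₁ : ∀ x ∈ S2, IsMeanCurvAt F₁ x (ν₁ x) (H x))
    (hH₂ : ∀ x ∈ S2, IsMeanCurvAt F₂ x (ν₂ x) (H x)) :
    ∀ x ∈ S2, ∀ v w : E3, Tang x v → Tang x w →
      sff F₁ x (ν₁ x) v w = sff F₂ x (ν₂ x) v w := by

  intro p hpS v w hv hw
  have hpp := (bp_mem_S2 p).1 hpS
  obtain ⟨e1, e2, h11, h22, h12, h1p, h2p⟩ := bp_exists_frame p hpp
  have i1 := bp_ster_inner e1 e2 p h11 h22 hpp h12 h1p h2p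
  have i2 := bp_ster_inner e1 (-e2) (-p) h11 (by simpa using h22) (by simpa using hpp)
    (by simpa using h12) (by simpa using h1p) (by simpa using h2p)
  have hcp : ∀ z, 0 < 4 / bp_s z ^ 2 := fun z => div_pos (by norm_num) (pow_pos (bp_s_pos z) 2)
  set Ψ := bp_ster e1 e2 p with hΨ
  set Φ := bp_ster e1 (-e2) (-p) with hΦ
  set l : ℂ → ℝ := fun z => bp_Q F₁ F₂ ν₁ ν₂ (Ψ z) (pd 1 Ψ z) (pd 1 Ψ z) with hl
  set m : ℂ → ℝ := fun z => bp_Q F₁ F₂ ν₁ ν₂ (Ψ z) (pd 1 Ψ z) (pd Complex.I Ψ z) with hm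
  set n : ℂ → ℝ := fun z => bp_Q F₁ F₂ ν₁ ν₂ (Ψ z) (pd Complex.I Ψ z) (pd Complex.I Ψ z) with hn
  set l' : ℂ → ℝ := fun z => bp_Q F₁ F₂ ν₁ ν₂ (Φ z) (pd 1 Φ z) (pd 1 Φ z) with hl'
  set m' : ℂ → ℝ := fun z => bp_Q F₁ F₂ ν₁ ν₂ (Φ z) (pd 1 Φ z) (pd Complex.I Φ z) with hm'
  set n' : ℂ → ℝ := fun z => bp_Q F₁ F₂ ν₁ ν₂ (Φ z) (pd Complex.I Φ z) (pd Complex.I Φ z) with hn'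
  obtain ⟨sr, sm, -, hJ⟩ := bp_conformal F₁ F₂ ν₁ ν₂ H h₁ h₂ hν₁ hν₂ hmet hH₁ hH₂ Ψ
    (bp_sm_ster _ _ _) (fun z => (i1 z).1) _ hcp (fun z => by rw [(i1 z).2]; simp)
    (fun z => by rw [(i1 z).2]; simp) (fun z => by rw [(i1 z).2]; simp) l m n hl hm hn
  obtain ⟨sr', sm', hz', -⟩ := bp_conformal F₁ F₂ ν₁ ν₂ H h₁ h₂ hν₁ hν₂ hmet hH₁ hH₂ Φ
    (bp_sm_ster _ _ _) (fun z => (i2 z).1) _ hcp (fun z => by rw [(i2 z).2]; simp)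
    (fun z => by rw [(i2 z).2]; simp) (fun z => by rw [(i2 z).2]; simp) l' m' n' hl' hm' hn'
  set bh : ℂ → ℂ := fun z => ⟨(l' z - n' z) / 2, -m' z⟩ with hbh
  have sbh : Sm bh := by
    have : bh = fun z => Complex.equivRealProdCLM.symm ((l' z - n' z) / 2, -m' z) := by
      funext z; rfl
    rw [this]
    exact Complex.equivRealProdCLM.symm.contDiff.comp (ContDiff.prodMk sr' (ContDiff.neg sm'))
  by_cases hb0 : bh 0 = 0
  · have hr0 : (l' 0 - n' 0) / 2 = 0 := congrArg Complex.re hb0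
    have hm0 : m' 0 = 0 := neg_eq_zero.1 (congrArg Complex.im hb0)
    obtain ⟨hl0, hn0⟩ := hz' 0 hr0 hm0
    have hs0 : bp_s 0 = 1 := by simp [bp_s]
    have hΦ0 : Φ 0 = p := by
      rw [hΦ]; unfold bp_ster bp_num; rw [hs0]; simp; norm_num
    have hU : pd 1 Φ 0 = (2 : ℝ) • e1 := by
      rw [hΦ, bp_pd_ster, hs0, bp_pd_s]; simp
    have hV : pd Complex.I Φ 0 = (-2 : ℝ) • e2 := by
      rw [hΦ, bp_pd_ster, hs0, bp_pd_s]; simp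
    simp only [hl', hm', hn', hΦ0] at hl0 hm0 hn0
    have d : ∀ u : E3, Tang p u → ∃ a b : ℝ, u = a • pd 1 Φ 0 + b • pd Complex.I Φ 0 := by
      intro u hu
      refine ⟨⟪u, e1⟫ / 2, -⟪u, e2⟫ / 2, ?_⟩
      rw [hU, hV, smul_smul, smul_smul]
      conv_lhs => rw [bp_decomp e1 e2 p u h11 h22 hpp h12 h1p h2p hu]
      congr 2 <;> ring
    obtain ⟨a, b, hab⟩ := d v hv
    obtain ⟨a', b', hab'⟩ := d w hw
    have := bp_Q_comb F₁ F₂ ν₁ ν₂ h₁.1 h₂.1 p (pd 1 Φ 0) (pd Complex.I Φ 0) a b a' b'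
    rw [← hab, ← hab', hl0, hm0, hn0] at this
    simp only [bp_Q] at this
    linarith
  · exfalso
    have hflux := bp_flux (fun z => (l z - n z) / 2) (fun z => -m z) bh sbh hb0 (by
      intro z hz
      obtain ⟨α, β, hα⟩ : ∃ α β : ℝ, z⁻¹ ^ 2 = ⟨α, β⟩ := ⟨_, _, rfl⟩
      have hx : pd 1 Ψ z = (-α) • pd 1 Φ z⁻¹ + (-β) • pd Complex.I Φ z⁻¹ := by
        rw [hΨ, bp_pd_inv _ _ _ z hz, bp_pd_lin, hα]; simp [hΦ]
      have hy : pd Complex.I Ψ z = β • pd 1 Φ z⁻¹ + (-α) • pd Complex.I Φ z⁻¹ := by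
        rw [hΨ, bp_pd_inv _ _ _ z hz, bp_pd_lin, hα]; simp [hΦ]
      have h0 : Ψ z = Φ z⁻¹ := bp_ster_inv _ _ _ z hz
      have el : l z = α ^ 2 * l' z⁻¹ + 2 * α * β * m' z⁻¹ + β ^ 2 * n' z⁻¹ := by
        simp only [hl, hl', hm', hn']
        rw [hx, h0, bp_Q_comb _ _ _ _ h₁.1 h₂.1]; ring
      have en : n z = β ^ 2 * l' z⁻¹ - 2 * α * β * m' z⁻¹ + α ^ 2 * n' z⁻¹ := by
        simp only [hn, hl', hm', hn']
        rw [hy, h0, bp_Q_comb _ _ _ _ h₁.1 h₂.1]; ring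
      have em : m z = -α * β * l' z⁻¹ + (α ^ 2 - β ^ 2) * m' z⁻¹ + α * β * n' z⁻¹ := by
        simp only [hm, hl', hm', hn']
        rw [hx, hy, h0, bp_Q_comb _ _ _ _ h₁.1 h₂.1]; ring
      have h4 : z⁻¹ ^ 4 = (z⁻¹ ^ 2) * (z⁻¹ ^ 2) := by ring
      rw [h4, hα, el, en, em]
      apply Complex.ext
      · simp only [hbh, Complex.mul_re, Complex.mul_im]; ring
      · simp only [hbh, Complex.mul_re, Complex.mul_im]; ring)
    exact bp_no_winding _ _ sr (ContDiff.neg sm) hJ hflux
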